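/- arXiv:math/0505474 — 6 statements merged into one kernel-verified Lean document; each statement's English description precedes it below -/
import Mathlib

section
/- Let m₁, m₂ be positive integers and let c be a real number. In the 2-torus T := (ℝ/2πℤ) × (ℝ/2πℤ) (with the product topology of two copies of the additive circle of period 2π), consider the subset Σ of all (θ₁, θ₂) ∈ T such that the element c − m₁·θ₁ − m₂·θ₂ of ℝ/2πℤ (computed using the ℤ-module structure of ℝ/2πℤ and the image of c) lies in the image of the open interval (π/2, 3π/2) under the projection ℝ → ℝ/2πℤ. Then Σ is an open subset of T having exactly gcd(m₁, m₂) connected components. -/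
open Real

/-- The set of Stokes directions of the elementary model connection `e^α`,
`α = x₁^{-m₁} x₂^{-m₂} u(x)`, `c = arg u(0)`, inside the 2-torus
`(ℝ/2πℤ) × (ℝ/2πℤ)`. -/
def stokesDirections (m₁ m₂ : ℕ) (c : ℝ) :
    Set (AddCircle (2 * π) × AddCircle (2 * π)) :=
  {θ | ((c : AddCircle (2 * π)) - (m₁ : ℤ) • θ.1 - (m₂ : ℤ) • θ.2)
      ∈ (fun r : ℝ => (r : AddCircle (2 * π))) '' Set.Ioo (π / 2) (3 * π / 2)}

/-- A set partitioned into open connected pieces has those pieces as its connected components. -/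
theorem Nat.card_connectedComponents_iUnion {X ι : Type*} [TopologicalSpace X] {U : ι → Set X}
    {S : Set X} (hS : S = ⋃ i, U i) (ho : ∀ i, IsOpen (U i)) (hc : ∀ i, IsConnected (U i))
    (hd : ∀ i j x, x ∈ U i → x ∈ U j → i = j) :
    Nat.card (ConnectedComponents S) = Nat.card ι := by
  have hmem : ∀ x : S, ∃ i, (x : X) ∈ U i := fun x =>
    Set.mem_iUnion.1 (hS.subset x.2)
  choose f hf using hmem
  let _ : TopologicalSpace ι := ⊥
  have : DiscreteTopology ι := ⟨rfl⟩
  have hpre : ∀ i, f ⁻¹' {i} = ((↑) : S → X) ⁻¹' U i := fun i => by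
    ext x
    constructor
    · rintro rfl
      exact hf x
    · exact fun hx => hd _ _ _ (hf x) hx
  have hcont : Continuous f := continuous_discrete_rng.2 fun i => by
    rw [hpre]
    exact (ho i).preimage continuous_subtype_val
  have hsub : ∀ i, U i ⊆ S := fun i => hS ▸ Set.subset_iUnion U i
  refine Nat.card_congr (Equiv.ofBijective hcont.connectedComponentsLift ⟨?_, ?_⟩)
  · intro p q
    obtain ⟨x, rfl⟩ := ConnectedComponents.surjective_coe p
    obtain ⟨y, rfl⟩ := ConnectedComponents.surjective_coe q
    simp only [Continuous.connectedComponentsLift_apply_coe]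
    intro hxy
    rw [ConnectedComponents.coe_eq_coe']
    have hconn : IsPreconnected (((↑) : S → X) ⁻¹' U (f y)) := by
      rw [← Topology.IsInducing.subtypeVal.isPreconnected_image, Subtype.image_preimage_coe,
        Set.inter_eq_right.2 (hsub _)]
      exact (hc _).isPreconnected
    exact hconn.subset_connectedComponent (hf y) (hxy ▸ hf x)
  · intro i
    obtain ⟨x, hx⟩ := (hc i).nonempty
    exact ⟨((⟨x, hsub i hx⟩ : S) : ConnectedComponents S), hd _ _ _ (hf _) hx⟩

/-- For `a`, `b` coprime, the part of the torus where `a • θ₁ + b • θ₂` lies in a given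
connected set is connected. -/
theorem isConnected_setOf_zsmul_add_zsmul_mem {p : ℝ} {a b : ℤ} (hab : IsCoprime a b)
    {A : Set (AddCircle p)} (hA : IsConnected A) :
    IsConnected {θ : AddCircle p × AddCircle p | a • θ.1 + b • θ.2 ∈ A} := by
  obtain ⟨u, v, huv⟩ := hab
  have himage : {θ : AddCircle p × AddCircle p | a • θ.1 + b • θ.2 ∈ A} =
      (fun q : AddCircle p × AddCircle p => (u • q.1 - b • q.2, v • q.1 + a • q.2)) ''
        (A ×ˢ Set.univ) := by
    ext ⟨x, y⟩
    simp only [Set.mem_ofPred_eq, Set.mem_image, Set.mem_prod, Set.mem_univ, and_true,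
      Prod.exists, Prod.mk.injEq]
    constructor
    · intro h
      refine ⟨_, u • y - v • x, h, ?_, ?_⟩
      · have hx := congrArg (· • x) huv
        simp only [one_smul] at hx
        conv_rhs => rw [← hx]
        module
      · have hy := congrArg (· • y) huv
        simp only [one_smul] at hy
        conv_rhs => rw [← hy]
        module
    · rintro ⟨s, t, hs, rfl, rfl⟩
      convert hs using 1
      have hs' := congrArg (· • s) huv
      simp only [one_smul] at hs'
      conv_rhs => rw [← hs']
      module
  rw [himage]
  have huniv : IsConnected (Set.univ : Set (AddCircle p)) := by
    rw [← (QuotientAddGroup.mk_surjective (s := AddSubgroup.zmultiples p)).range_eq]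
    exact isConnected_range (AddCircle.continuous_mk' p)
  exact (hA.prod huniv).image _ (by fun_prop)

/-- The preimage of the sector `(π / 2, 3 * π / 2)` under `s ↦ c - g * s`, on the `k`-th sheet. -/
def stokesInterval (g : ℕ) (c : ℝ) (k : ℤ) : Set ℝ :=
  {x | c - g * x + 2 * π * k ∈ Set.Ioo (π / 2) (3 * π / 2)}

theorem isOpen_stokesInterval (g : ℕ) (c : ℝ) (k : ℤ) : IsOpen (stokesInterval g c k) :=
  isOpen_Ioo.preimage (by fun_prop)

theorem isConnected_stokesInterval {g : ℕ} (hg : 0 < g) (c : ℝ) (k : ℤ) :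
    IsConnected (stokesInterval g c k) := by
  have hg' : (g : ℝ) ≠ 0 := by positivity
  have himage : stokesInterval g c k =
      (fun r : ℝ => (c - r + 2 * π * k) / g) '' Set.Ioo (π / 2) (3 * π / 2) := by
    ext x
    constructor
    · exact fun hx => ⟨_, hx, by field_simp; ring⟩
    · rintro ⟨r, hr, rfl⟩
      have : c - g * ((c - r + 2 * π * k) / g) + 2 * π * k = r := by field_simp; ring
      simpa only [stokesInterval, Set.mem_ofPred_eq, this] using hr
  rw [himage]
  exact (isConnected_Ioo (by linarith [pi_pos])).image _ (by fun_prop)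

theorem AddCircle.coe_eq_coe_iff_exists_zsmul {p x y : ℝ} :
    (x : AddCircle p) = y ↔ ∃ n : ℤ, y = x + n • p := by
  rw [eq_comm, ← sub_eq_zero, ← AddCircle.coe_sub, AddCircle.coe_eq_zero_iff]
  exact exists_congr fun n => by rw [eq_comm, sub_eq_iff_eq_add']

theorem sub_nsmul_mem_iff_exists_stokesInterval {g : ℕ} (hg : 0 < g) (c : ℝ)
    (s : AddCircle (2 * π)) :
    (c : AddCircle (2 * π)) - g • s ∈
        (fun r : ℝ => (r : AddCircle (2 * π))) '' Set.Ioo (π / 2) (3 * π / 2) ↔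
      ∃ k : Fin g, s ∈ (fun r : ℝ => (r : AddCircle (2 * π))) '' stokesInterval g c (k : ℕ) := by
  constructor
  · obtain ⟨x, rfl⟩ := QuotientAddGroup.mk_surjective s
    rintro ⟨r, hr, h⟩
    obtain ⟨n, hn⟩ := AddCircle.coe_eq_coe_iff_exists_zsmul.1
      (show ((c - g • x : ℝ) : AddCircle (2 * π)) = (r : ℝ) from h.symm)
    rw [nsmul_eq_mul, zsmul_eq_mul] at hn
    have hgz : (0 : ℤ) < g := by exact_mod_cast hg
    have hnonneg := Int.emod_nonneg n hgz.ne'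
    have hlt := Int.emod_lt_of_pos n hgz
    have hk : (((n % g).toNat : ℕ) : ℤ) = n % g := Int.toNat_of_nonneg hnonneg
    refine ⟨⟨(n % g).toNat, by omega⟩, x + (-(n / g) : ℤ) * (2 * π), ?_, ?_⟩
    · have hdiv : ((n % g : ℤ) : ℝ) + g * (n / g : ℤ) = n := by
        exact_mod_cast Int.emod_add_mul_ediv n g
      have hr' : c - g * (x + (-(n / g) : ℤ) * (2 * π)) + 2 * π * (n % g : ℤ) = r := by
        rw [Int.cast_neg]
        linear_combination 2 * π * hdiv - hn
      simpa only [stokesInterval, Set.mem_ofPred_eq, hk, hr'] using hr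
    · exact AddCircle.coe_eq_coe_iff_exists_zsmul.2 ⟨n / g, by simp⟩
  · rintro ⟨k, x, hx, rfl⟩
    refine ⟨_, hx, ?_⟩
    exact AddCircle.coe_eq_coe_iff_exists_zsmul.2
      (⟨-(k : ℕ), by simp; ring⟩ : ∃ n : ℤ, c - g • x = _ + n • (2 * π))

theorem eq_of_mem_image_stokesInterval {g : ℕ} (c : ℝ) (k l : Fin g) (s : AddCircle (2 * π))
    (hk : s ∈ (fun r : ℝ => (r : AddCircle (2 * π))) '' stokesInterval g c (k : ℕ))
    (hl : s ∈ (fun r : ℝ => (r : AddCircle (2 * π))) '' stokesInterval g c (l : ℕ)) : k = l := by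
  obtain ⟨x, hx, rfl⟩ := hk
  obtain ⟨y, hy, hxy⟩ := hl
  obtain ⟨n, hn⟩ := AddCircle.coe_eq_coe_iff_exists_zsmul.1 hxy
  obtain ⟨hx₁, hx₂⟩ := hx
  obtain ⟨hy₁, hy₂⟩ := hy
  rw [zsmul_eq_mul] at hn
  subst hn
  have hlt₁ : ((k : ℕ) : ℝ) - (l : ℕ) - g * n < 1 := by
    by_contra! hge
    have := mul_le_mul_of_nonneg_left hge pi_pos.le
    push_cast at *
    linarith
  have hlt₂ : -1 < ((k : ℕ) : ℝ) - (l : ℕ) - g * n := by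
    by_contra! hge
    have := mul_le_mul_of_nonneg_left hge pi_pos.le
    push_cast at *
    linarith
  have hz₁ : ((k : ℕ) : ℤ) - (l : ℕ) - g * n < 1 := by exact_mod_cast hlt₁
  have hz₂ : -1 < ((k : ℕ) : ℤ) - (l : ℕ) - g * n := by exact_mod_cast hlt₂
  have hmod : ((k : ℕ) : ℤ) ≡ (l : ℕ) [ZMOD g] :=
    (Int.modEq_iff_dvd.2 ⟨n, by omega⟩ : ((l : ℕ) : ℤ) ≡ (k : ℕ) [ZMOD g]).symm
  exact Fin.ext ((Int.natCast_modEq_iff.1 hmod).eq_of_lt_of_lt k.2 l.2)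

/-- The set of Stokes directions on the torus `(ℝ/2πℤ) × (ℝ/2πℤ)` is open and
has exactly `gcd m₁ m₂` connected components. -/
theorem stokesDirections_isOpen_and_card_connectedComponents
    (m₁ m₂ : ℕ) (hm₁ : 0 < m₁) (hm₂ : 0 < m₂) (c : ℝ) :
    IsOpen (stokesDirections m₁ m₂ c) ∧
      Nat.card (ConnectedComponents (stokesDirections m₁ m₂ c)) = Nat.gcd m₁ m₂ := by
  have hg : 0 < Nat.gcd m₁ m₂ := Nat.gcd_pos_of_pos_left _ hm₁
  obtain ⟨a, b, hab, ha, hb⟩ := Nat.exists_coprime m₁ m₂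
  set g := Nat.gcd m₁ m₂
  let U : Fin g → Set (AddCircle (2 * π) × AddCircle (2 * π)) := fun k =>
    {θ | (a : ℤ) • θ.1 + (b : ℤ) • θ.2 ∈
      (fun r : ℝ => (r : AddCircle (2 * π))) '' stokesInterval g c (k : ℕ)}
  have hS : stokesDirections m₁ m₂ c = ⋃ k, U k := by
    ext θ
    have hθ : (c : AddCircle (2 * π)) - (m₁ : ℤ) • θ.1 - (m₂ : ℤ) • θ.2 =
        c - g • ((a : ℤ) • θ.1 + (b : ℤ) • θ.2) := by
      rw [ha, hb]
      push_cast
      module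
    rw [stokesDirections, Set.mem_ofPred_eq, hθ, sub_nsmul_mem_iff_exists_stokesInterval hg,
      Set.mem_iUnion]
    rfl
  have ho : ∀ k, IsOpen (U k) := fun k =>
    (QuotientAddGroup.isOpenMap_coe _ (isOpen_stokesInterval g c (k : ℕ))).preimage
      (by fun_prop)
  refine ⟨hS ▸ isOpen_iUnion ho, ?_⟩
  rw [Nat.card_connectedComponents_iUnion hS ho
    (fun k => isConnected_setOf_zsmul_add_zsmul_mem (Nat.isCoprime_iff_coprime.2 hab)
      ((isConnected_stokesInterval hg c (k : ℕ)).image _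
        (AddCircle.continuous_mk' _).continuousOn))
    (fun k l θ => eq_of_mem_image_stokesInterval c k l _), Nat.card_fin]
end

section
/- Let m₁, m₂ be positive integers and let c be a real number with image c̄ in ℝ/2πℤ. In the 2-torus T := (ℝ/2πℤ) × (ℝ/2πℤ), the closed subset K := {(θ₁, θ₂) ∈ T : m₁·θ₁ + m₂·θ₂ = c̄} has exactly gcd(m₁, m₂) connected components. -/
open Real

/-- The torus knot `{(θ₁, θ₂) : m₁·θ₁ + m₂·θ₂ = c̄}` of type `(m₁, m₂)` inside the
2-torus `(ℝ/2πℤ) × (ℝ/2πℤ)`. -/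
def torusKnot (m₁ m₂ : ℕ) (c : ℝ) :
    Set (AddCircle (2 * π) × AddCircle (2 * π)) :=
  {θ | (m₁ : ℤ) • θ.1 + (m₂ : ℤ) • θ.2 = (c : AddCircle (2 * π))}

/-- The points of the circle whose `d`-fold multiple is `c` are the translates of `c / d` by
multiples of `p / d`. -/
lemma AddCircle.nsmul_eq_coe_iff {p : ℝ} {d : ℕ} (hd : d ≠ 0) (c : ℝ) (x : AddCircle p) :
    d • x = (c : AddCircle p) ↔
      ∃ k : Fin d, ((c / d : ℝ) : AddCircle p) + (k : ℕ) • ((p / d : ℝ) : AddCircle p) = x := by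
  have hc : (c : AddCircle p) = d • ((c / d : ℝ) : AddCircle p) := by
    rw [← AddCircle.coe_nsmul, nsmul_eq_mul, mul_div_cancel₀ c (Nat.cast_ne_zero.mpr hd)]
  rw [hc]
  refine (QuotientAddGroup.zmultiples_nsmul_eq_nsmul_iff hd).trans ?_
  exact exists_congr fun k => eq_comm

lemma AddCircle.injective_add_nsmul_div {p : ℝ} [hp : Fact (0 < p)] {d : ℕ}
    (y : AddCircle p) :
    Function.Injective fun k : Fin d => y + (k : ℕ) • ((p / d : ℝ) : AddCircle p) := by
  intro j k h
  have hd : 0 < d := j.pos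
  have hord := AddCircle.addOrderOf_period_div (p := p) hd
  have h' := nsmul_injOn_Iio_addOrderOf (x := ((p / d : ℝ) : AddCircle p))
    (by rw [hord]; exact j.2) (by rw [hord]; exact k.2) (add_left_cancel h)
  exact Fin.ext h'

/-- The solutions of `a • x + b • y = t` with Bézout coefficients `u, v` for `a, b` are
parametrized by `s ↦ (u • t + b • s, v • t - a • s)`. -/
lemma zsmul_add_zsmul_eq_iff_exists {G : Type*} [AddCommGroup G] {a b u v : ℤ}
    (h : a * u + b * v = 1) (t x y : G) :
    a • x + b • y = t ↔ ∃ s : G, u • t + b • s = x ∧ v • t - a • s = y := by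
  constructor
  · rintro rfl
    refine ⟨v • x - u • y, ?_, ?_⟩
    · linear_combination (norm := module) h • x
    · linear_combination (norm := module) h • y
  · rintro ⟨s, rfl, rfl⟩
    linear_combination (norm := module) h • t

lemma isClosed_torusKnot (m₁ m₂ : ℕ) (c : ℝ) : IsClosed (torusKnot m₁ m₂ c) :=
  isClosed_eq (by fun_prop) continuous_const

/-- The piece of the torus knot of type `(m₁, m₂)` on which the character `(a, b)` equals `t`. -/
def torusKnotFiber (m₁ m₂ : ℕ) (c : ℝ) (a b : ℤ) (t : AddCircle (2 * π)) :
    Set (torusKnot m₁ m₂ c) :=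
  {θ | a • θ.1.1 + b • θ.1.2 = t}

lemma isConnected_torusKnotFiber {m₁ m₂ d : ℕ} {c : ℝ} {a b u v : ℤ}
    (h₁ : (m₁ : ℤ) = d * a) (h₂ : (m₂ : ℤ) = d * b) (h : a * u + b * v = 1)
    {t : AddCircle (2 * π)} (ht : d • t = (c : AddCircle (2 * π))) :
    IsConnected (torusKnotFiber m₁ m₂ c a b t) := by
  have : Fact (0 < 2 * π) := ⟨two_pi_pos⟩
  let f : AddCircle (2 * π) → AddCircle (2 * π) × AddCircle (2 * π) :=
    fun s => (u • t + b • s, v • t - a • s)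
  have hf : ∀ s, a • (f s).1 + b • (f s).2 = t := fun s =>
    (zsmul_add_zsmul_eq_iff_exists h t _ _).mpr ⟨s, rfl, rfl⟩
  have hmem : ∀ s, f s ∈ torusKnot m₁ m₂ c := fun s => by
    change (m₁ : ℤ) • (f s).1 + (m₂ : ℤ) • (f s).2 = _
    rw [h₁, h₂, mul_smul, mul_smul, ← smul_add, hf, natCast_zsmul, ht]
  have hcont : Continuous fun s => (⟨f s, hmem s⟩ : torusKnot m₁ m₂ c) :=
    Continuous.subtype_mk (by fun_prop) _
  convert isConnected_range hcont
  ext ⟨⟨x, y⟩, hxy⟩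
  simpa [torusKnotFiber, f] using zsmul_add_zsmul_eq_iff_exists h t x y

/-- The torus knot of type `(m₁, m₂)` on the torus `(ℝ/2πℤ) × (ℝ/2πℤ)` is closed
and has exactly `gcd m₁ m₂` connected components. -/
theorem torusKnot_isClosed_and_card_connectedComponents
    (m₁ m₂ : ℕ) (hm₁ : 0 < m₁) (hm₂ : 0 < m₂) (c : ℝ) :
    IsClosed (torusKnot m₁ m₂ c) ∧
      Nat.card (ConnectedComponents (torusKnot m₁ m₂ c)) = Nat.gcd m₁ m₂ := by
  refine ⟨isClosed_torusKnot m₁ m₂ c, ?_⟩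
  have : Fact (0 < 2 * π) := ⟨two_pi_pos⟩
  set d := Nat.gcd m₁ m₂
  have hd0 : d ≠ 0 := (Nat.gcd_pos_of_pos_left m₂ hm₁).ne'
  obtain ⟨a, ha⟩ : (d : ℤ) ∣ m₁ := Int.natCast_dvd_natCast.mpr (Nat.gcd_dvd_left m₁ m₂)
  obtain ⟨b, hb⟩ : (d : ℤ) ∣ m₂ := Int.natCast_dvd_natCast.mpr (Nat.gcd_dvd_right m₁ m₂)
  have hbez : a * Nat.gcdA m₁ m₂ + b * Nat.gcdB m₁ m₂ = 1 := by
    have h := Nat.gcd_eq_gcd_ab m₁ m₂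
    apply mul_left_cancel₀ (Nat.cast_ne_zero.mpr hd0 : (d : ℤ) ≠ 0)
    linear_combination -h - Nat.gcdA m₁ m₂ * ha - Nat.gcdB m₁ m₂ * hb
  let t : Fin d → AddCircle (2 * π) := fun k =>
    ((c / d : ℝ) : AddCircle (2 * π)) + (k : ℕ) • ((2 * π / d : ℝ) : AddCircle (2 * π))
  have ht : ∀ x, d • x = (c : AddCircle (2 * π)) ↔ ∃ k, t k = x :=
    AddCircle.nsmul_eq_coe_iff hd0 c
  let U : Fin d → Set (torusKnot m₁ m₂ c) := fun k => torusKnotFiber m₁ m₂ c a b (t k)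
  have hclosed : ∀ k, IsClosed (U k) := fun k => isClosed_eq (by fun_prop) continuous_const
  have hdisj : Pairwise (Function.onFun Disjoint U) := fun j k hjk =>
    Set.disjoint_left.mpr fun θ hj hk =>
      hjk (AddCircle.injective_add_nsmul_div _ (Eq.trans (Eq.symm hj) hk))
  have hunion : ⋃ k, U k = Set.univ := by
    refine Set.iUnion_eq_univ_iff.mpr fun θ => ?_
    have hθ : (m₁ : ℤ) • θ.1.1 + (m₂ : ℤ) • θ.1.2 = (c : AddCircle (2 * π)) := θ.2
    rw [ha, hb, mul_smul, mul_smul, ← smul_add, natCast_zsmul] at hθ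
    obtain ⟨k, hk⟩ := (ht _).mp hθ
    exact ⟨k, hk.symm⟩
  have hclopen : ∀ k, IsClopen (U k) := fun k => by
    refine ⟨hclosed k, ?_⟩
    have hcompl : (U k)ᶜ = ⋃ j ∈ ({k}ᶜ : Set (Fin d)), U j := by
      ext θ
      obtain ⟨i, hi⟩ := Set.iUnion_eq_univ_iff.mp hunion θ
      have huniq : ∀ j, θ ∈ U j → j = i := fun j hj =>
        hdisj.eq (Set.not_disjoint_iff.mpr ⟨θ, hj, hi⟩)
      simp only [Set.mem_compl_iff, Set.mem_iUnion, Set.mem_singleton_iff, exists_prop]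
      exact ⟨fun h => ⟨i, fun hik => h (hik ▸ hi), hi⟩,
        fun ⟨j, hjk, hj⟩ hk => hjk ((huniq j hj).trans (huniq k hk).symm)⟩
    rw [← isClosed_compl_iff, hcompl]
    exact (Set.toFinite _).isClosed_biUnion fun j _ => hclosed j
  have hconn : ∀ k, IsConnected (U k) := fun k =>
    isConnected_torusKnotFiber ha hb hbez ((ht _).mpr ⟨k, rfl⟩)
  rw [Nat.card_congr (ConnectedComponents.equivOfIsClopenOfIsConnected hclopen hdisj hunion hconn),
    Nat.card_fin]
end

section
/- Let m₁, m₂ be positive integers and set d := gcd(m₁, m₂). Let V be the ℂ-vector space of all families u : ℕ × ℕ → ℂ satisfying, for every pair (k, l) with k ≥ m₁ and l ≥ m₂, the two recursions k·u(k,l) + m₁·u(k−m₁, l−m₂) = 0 and l·u(k,l) + m₂·u(k−m₁, l−m₂) = 0. Then (i) every u ∈ V satisfies u(k,l) = 0 whenever m₂·k ≠ m₁·l, and (ii) V is finite-dimensional of dimension exactly d. -/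
/-- The space of families `u : ℕ × ℕ → ℂ` solving both recursions of step `(m₁, m₂)`. -/
def recursionSolutions (m₁ m₂ : ℕ) : Submodule ℂ (ℕ × ℕ → ℂ) where
  carrier := {u | ∀ k l : ℕ, m₁ ≤ k → m₂ ≤ l →
    (k : ℂ) * u (k, l) + (m₁ : ℂ) * u (k - m₁, l - m₂) = 0 ∧
    (l : ℂ) * u (k, l) + (m₂ : ℂ) * u (k - m₁, l - m₂) = 0}
  zero_mem' := by intro k l _ _; simp
  add_mem' := by
    intro u v hu hv k l hk hl
    obtain ⟨hu₁, hu₂⟩ := hu k l hk hl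
    obtain ⟨hv₁, hv₂⟩ := hv k l hk hl
    simp only [Pi.add_apply]
    exact ⟨by linear_combination hu₁ + hv₁, by linear_combination hu₂ + hv₂⟩
  smul_mem' := by
    intro c u hu k l hk hl
    obtain ⟨hu₁, hu₂⟩ := hu k l hk hl
    simp only [Pi.smul_apply, smul_eq_mul]
    exact ⟨by linear_combination c * hu₁, by linear_combination c * hu₂⟩

/-- The recursions with the indices shifted so that no subtraction occurs. -/
theorem mem_recursionSolutions_iff_add {m₁ m₂ : ℕ} {u : ℕ × ℕ → ℂ} :
    u ∈ recursionSolutions m₁ m₂ ↔ ∀ k l : ℕ,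
      ((k : ℂ) + m₁) * u (k + m₁, l + m₂) + m₁ * u (k, l) = 0 ∧
      ((l : ℂ) + m₂) * u (k + m₁, l + m₂) + m₂ * u (k, l) = 0 := by
  constructor
  · intro hu k l
    simpa using hu (k + m₁) (l + m₂) (Nat.le_add_left _ _) (Nat.le_add_left _ _)
  · intro hu k l hk hl
    obtain ⟨k, rfl⟩ := Nat.exists_eq_add_of_le' hk
    obtain ⟨l, rfl⟩ := Nat.exists_eq_add_of_le' hl
    simpa using hu k l

theorem eq_zero_of_mem_recursionSolutions {m₁ m₂ : ℕ} (hm₁ : 0 < m₁) {u : ℕ × ℕ → ℂ}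
    (hu : u ∈ recursionSolutions m₁ m₂) {k l : ℕ} (hkl : m₂ * k ≠ m₁ * l) : u (k, l) = 0 := by
  obtain ⟨h₁, h₂⟩ := mem_recursionSolutions_iff_add.1 hu k l
  have hne : (m₂ * k - m₁ * l : ℂ) ≠ 0 := sub_ne_zero.2 (by exact_mod_cast hkl)
  have hnext : u (k + m₁, l + m₂) = 0 :=
    (mul_eq_zero.1 (show (m₂ * k - m₁ * l : ℂ) * u (k + m₁, l + m₂) = 0 by
      linear_combination (m₂ : ℂ) * h₁ - (m₁ : ℂ) * h₂)).resolve_left hne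
  simpa [hnext, hm₁.ne'] using h₁

/-- For coprime `a` and `b`, the line `b * d * k = a * d * l` is parametrized by
`t ↦ (a * t, b * t)`. -/
theorem exists_eq_mul_of_mul_eq_mul {a b d k l : ℕ} (hd : 0 < d) (ha : 0 < a)
    (hab : a.Coprime b) (h : b * d * k = a * d * l) : ∃ t, k = a * t ∧ l = b * t := by
  have h' : b * k = a * l := Nat.eq_of_mul_eq_mul_left hd (by linarith)
  obtain ⟨t, rfl⟩ := hab.dvd_of_dvd_mul_left (Dvd.intro l h'.symm)
  exact ⟨t, rfl, Nat.eq_of_mul_eq_mul_left ha (by linarith)⟩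

/-- Restriction of a solution to the first `d` points of the line through `(a, b)`. -/
def lineRestriction (a b d : ℕ) : recursionSolutions (a * d) (b * d) →ₗ[ℂ] (Fin d → ℂ) where
  toFun u i := u.1 (a * i, b * i)
  map_add' _ _ := rfl
  map_smul' _ _ := rfl

theorem lineRestriction_injective {a b d : ℕ} (ha : 0 < a) (hd : 0 < d)
    (hab : a.Coprime b) : Function.Injective (lineRestriction a b d) := by
  rw [injective_iff_map_eq_zero]
  rintro ⟨u, hu⟩ h0
  have hline : ∀ t : ℕ, u (a * t, b * t) = 0 := by
    intro t
    induction t using Nat.strong_induction_on with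
    | _ t ih =>
      rcases lt_or_ge t d with ht | ht
      · exact congrFun h0 ⟨t, ht⟩
      · obtain ⟨s, rfl⟩ := Nat.exists_eq_add_of_le' ht
        have h := (mem_recursionSolutions_iff_add.1 hu (a * s) (b * s)).1
        rw [ih s (by omega), mul_zero, add_zero, ← mul_add, ← mul_add] at h
        exact (mul_eq_zero.1 h).resolve_left (by norm_cast; positivity)
  ext ⟨k, l⟩
  by_cases hkl : b * d * k = a * d * l
  · obtain ⟨t, rfl, rfl⟩ := exists_eq_mul_of_mul_eq_mul hd ha hab hkl
    exact hline t
  · exact eq_zero_of_mem_recursionSolutions (Nat.mul_pos ha hd) hu hkl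

/-- Any `d` initial values extend to a solution of the one-variable recursion of step `d`. -/
theorem exists_recursion_extension {d : ℕ} (hd : 0 < d) (c : Fin d → ℂ) :
    ∃ v : ℕ → ℂ, (∀ i : Fin d, v i = c i) ∧
      ∀ t : ℕ, ((t : ℂ) + d) * v (t + d) + d * v t = 0 := by
  refine ⟨fun t ↦ (∏ j ∈ Finset.range (t / d), (-d / ((t % d : ℕ) + d * (j + 1 : ℂ)))) *
    c ⟨t % d, Nat.mod_lt t hd⟩, fun i ↦ ?_, fun t ↦ ?_⟩
  · simp [Nat.div_eq_of_lt i.2, Nat.mod_eq_of_lt i.2]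
  · simp only [Nat.add_div_right t hd, Nat.add_mod_right, Finset.prod_range_succ]
    have ht : ((t % d : ℕ) : ℂ) + d * ((t / d : ℕ) + 1) = t + d := by
      have h : ((t % d + d * (t / d) : ℕ) : ℂ) = t := congrArg _ (Nat.mod_add_div t d)
      push_cast at h ⊢
      linear_combination h
    have hne : (t : ℂ) + d ≠ 0 := by norm_cast; omega
    rw [ht]
    field_simp
    ring

theorem lineRestriction_surjective {a b d : ℕ} (ha : 0 < a) (hd : 0 < d)
    (hab : a.Coprime b) : Function.Surjective (lineRestriction a b d) := by
  intro c
  obtain ⟨v, hvc, hv⟩ := exists_recursion_extension hd c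
  let u : ℕ × ℕ → ℂ := fun p ↦ if b * d * p.1 = a * d * p.2 then v (p.1 / a) else 0
  have hu_line (t : ℕ) : u (a * t, b * t) = v t := by
    have h : b * d * (a * t) = a * d * (b * t) := by ring
    simp [u, h, Nat.mul_div_cancel_left t ha]
  refine ⟨⟨u, mem_recursionSolutions_iff_add.2 fun k l ↦ ?_⟩,
    funext fun i ↦ (hu_line i).trans (hvc i)⟩
  by_cases hkl : b * d * k = a * d * l
  · obtain ⟨t, rfl, rfl⟩ := exists_eq_mul_of_mul_eq_mul hd ha hab hkl
    rw [← mul_add, ← mul_add, hu_line, hu_line]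
    push_cast
    exact ⟨by linear_combination (a : ℂ) * hv t, by linear_combination (b : ℂ) * hv t⟩
  · have hkl' : b * d * (k + a * d) ≠ a * d * (l + b * d) := fun h ↦ hkl (by linarith)
    simp [u, hkl, hkl']

/-- The solution space is isomorphic to the space of `d` initial values. -/
noncomputable def recursionSolutionsEquiv {a b d : ℕ} (ha : 0 < a) (hd : 0 < d)
    (hab : a.Coprime b) : recursionSolutions (a * d) (b * d) ≃ₗ[ℂ] (Fin d → ℂ) :=
  LinearEquiv.ofBijective (lineRestriction a b d)
    ⟨lineRestriction_injective ha hd hab, lineRestriction_surjective ha hd hab⟩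

theorem recursionSolutions_finite_and_finrank {m₁ m₂ : ℕ} (hm₁ : 0 < m₁) :
    Module.Finite ℂ (recursionSolutions m₁ m₂) ∧
      Module.finrank ℂ (recursionSolutions m₁ m₂) = Nat.gcd m₁ m₂ := by
  have hd : 0 < Nat.gcd m₁ m₂ := Nat.gcd_pos_of_pos_left _ hm₁
  obtain ⟨a, b, hab, h₁, h₂⟩ := Nat.exists_coprime m₁ m₂
  generalize Nat.gcd m₁ m₂ = d at *
  subst h₁ h₂
  let e := recursionSolutionsEquiv (Nat.pos_of_mul_pos_right hm₁) hd hab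
  exact ⟨Module.Finite.equiv e.symm, by simpa using e.finrank_eq⟩

/-- Claim 1 in the proof of Theorem 4.5 of the paper, coefficientwise: the space of
solutions `u : ℕ × ℕ → ℂ` of the recursions
`k·u(k,l) + m₁·u(k−m₁,l−m₂) = 0` and `l·u(k,l) + m₂·u(k−m₁,l−m₂) = 0`
(for `k ≥ m₁`, `l ≥ m₂`) is supported on the line `m₂·k = m₁·l` and has
dimension `gcd m₁ m₂`. -/
theorem kernel_recursion_dim_gcd (m₁ m₂ : ℕ) (hm₁ : 0 < m₁) (hm₂ : 0 < m₂) :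
    (∀ u : ℕ × ℕ → ℂ,
      (∀ k l : ℕ, m₁ ≤ k → m₂ ≤ l →
        (k : ℂ) * u (k, l) + (m₁ : ℂ) * u (k - m₁, l - m₂) = 0 ∧
        (l : ℂ) * u (k, l) + (m₂ : ℂ) * u (k - m₁, l - m₂) = 0) →
      ∀ k l : ℕ, m₂ * k ≠ m₁ * l → u (k, l) = 0) ∧
    ∃ V : Submodule ℂ (ℕ × ℕ → ℂ),
      (∀ u : ℕ × ℕ → ℂ, u ∈ V ↔
        ∀ k l : ℕ, m₁ ≤ k → m₂ ≤ l →
          (k : ℂ) * u (k, l) + (m₁ : ℂ) * u (k - m₁, l - m₂) = 0 ∧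
          (l : ℂ) * u (k, l) + (m₂ : ℂ) * u (k - m₁, l - m₂) = 0) ∧
      Module.Finite ℂ V ∧ Module.finrank ℂ V = Nat.gcd m₁ m₂ := by
  exact ⟨fun _ hu _ _ hkl ↦ eq_zero_of_mem_recursionSolutions hm₁ hu hkl,
    recursionSolutions m₁ m₂, fun _ ↦ Iff.rfl, recursionSolutions_finite_and_finrank hm₁⟩
end

section
/- Let m₁, m₂ be positive integers. For every entire function η : ℂ × ℂ → ℂ there exist entire functions a, b : ℂ × ℂ → ℂ such that, setting ω₁(x₁,x₂) := x₁^{m₁+1} x₂^{m₂} a(x₁,x₂) and ω₂(x₁,x₂) := x₁^{m₁} x₂^{m₂+1} b(x₁,x₂), one has for all (x₁,x₂) ∈ ℂ²: −x₁²·∂₁ω₂(x₁,x₂) + x₂²·∂₂ω₁(x₁,x₂) + m₂·x₁^{m₁}x₂^{m₂+1}·ω₁(x₁,x₂) − m₁·x₁^{m₁+1}x₂^{m₂}·ω₂(x₁,x₂) = x₁^{2m₁+1} x₂^{2m₂+1} η(x₁,x₂). -/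
/-- First complex partial derivative of a function `ℂ × ℂ → ℂ`. -/
noncomputable def pd1 (f : ℂ × ℂ → ℂ) : ℂ × ℂ → ℂ :=
  fun x => deriv (fun w => f (w, x.2)) x.1

/-- Second complex partial derivative of a function `ℂ × ℂ → ℂ`. -/
noncomputable def pd2 (f : ℂ × ℂ → ℂ) : ℂ × ℂ → ℂ :=
  fun x => deriv (fun w => f (x.1, w)) x.2

open MeasureTheory Metric Set

open scoped Interval Topology

/-- An integral over a compact interval of a continuous family of entire functions is entire. -/
theorem Differentiable.intervalIntegral_of_continuous_uncurry {E : Type*} [NormedAddCommGroup E]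
    [NormedSpace ℂ E] [FiniteDimensional ℂ E] {F : ℝ → E → ℂ} {a b : ℝ}
    (hF : Continuous F.uncurry) (hd : ∀ t, Differentiable ℂ (F t)) :
    Differentiable ℂ fun x => ∫ t in a..b, F t x := by
  intro x₀
  have : ProperSpace E := FiniteDimensional.proper ℂ E
  borelize E
  have hFx (x : E) : Continuous fun t => F t x := hF.comp (by fun_prop : Continuous fun t => (t, x))
  obtain ⟨M, hM⟩ := (isCompact_uIcc.prod (isCompact_closedBall x₀ 2)).exists_bound_of_continuousOn
    (s := [[a, b]] ×ˢ closedBall x₀ 2) hF.continuousOn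
  have hbound : ∀ t ∈ Ι a b, ∀ x ∈ ball x₀ 1, ‖fderiv ℂ (F t) x‖ ≤ (M + M) / 1 := by
    intro t ht x hx
    have hM' : ∀ y ∈ ball x 1, ‖F t y‖ ≤ M := fun y hy =>
      hM (t, y) ⟨uIoc_subset_uIcc ht, by
        have := dist_triangle y x x₀
        rw [mem_ball] at hx hy
        rw [mem_closedBall]
        linarith⟩
    refine Complex.norm_fderiv_le_div_of_mapsTo_ball (hd t).differentiableOn (fun y hy => ?_)
      one_pos
    rw [mem_closedBall, dist_eq_norm]
    exact (norm_sub_le _ _).trans (add_le_add (hM' y hy) (hM' x (mem_ball_self one_pos)))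
  have hmeas : Measurable fun t => fderiv ℂ (F t) x₀ :=
    (measurable_fderiv_with_param ℂ hF).comp (by fun_prop : Measurable fun t : ℝ => (t, x₀))
  exact (intervalIntegral.hasFDerivAt_integral_of_dominated_of_fderiv_le
    (F := fun x t => F t x) (F' := fun x t => fderiv ℂ (F t) x) (ball_mem_nhds x₀ one_pos)
    (.of_forall fun x => (hFx x).aestronglyMeasurable)
    ((hFx x₀).intervalIntegrable _ _) hmeas.aestronglyMeasurable
    (.of_forall hbound) intervalIntegrable_const
    (.of_forall fun t _ x _ => (hd t x).hasFDerivAt)).differentiableAt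

/-- For an entire function `k` of one variable, `s ^ (n + 1) * ∫ t in 0..1, t ^ n * k (t * s)` is a
primitive of `s ^ n * k s`. -/
theorem hasDerivAt_pow_mul_integral_pow_mul {k : ℂ → ℂ} (hk : Differentiable ℂ k) (n : ℕ) (z : ℂ) :
    HasDerivAt (fun s : ℂ => s ^ (n + 1) * ∫ t in (0 : ℝ)..1, (t : ℂ) ^ n * k (t * s))
      (z ^ n * k z) z := by
  have hp : Differentiable ℂ fun s : ℂ => s ^ n * k s := by fun_prop
  obtain ⟨K, hK⟩ := hp.isExactOn_univ
  have hint (s : ℂ) :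
      s ^ (n + 1) * ∫ t in (0 : ℝ)..1, (t : ℂ) ^ n * k (t * s) = K s - K 0 := by
    have hderiv : ∀ t ∈ [[(0 : ℝ), 1]], HasDerivAt (fun t : ℝ => K (t * s))
        (s ^ (n + 1) * ((t : ℂ) ^ n * k (t * s))) t := by
      intro t _
      have h := (hK (t * s) (mem_univ _)).comp (t : ℂ) ((hasDerivAt_id (t : ℂ)).mul_const s)
      refine h.comp_ofReal.congr_deriv ?_
      simp only
      ring
    have hcont : Continuous fun t : ℝ => s ^ (n + 1) * ((t : ℂ) ^ n * k (t * s)) := by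
      have := hk.continuous
      fun_prop
    rw [← intervalIntegral.integral_const_mul,
      intervalIntegral.integral_eq_sub_of_hasDerivAt hderiv (hcont.intervalIntegrable _ _)]
    simp
  simp only [hint]
  exact (hK z (mem_univ z)).sub_const _

/-- For entire `g` and `n : ℕ`, the equation `∂₂(x₂ ^ (n + 1) * A) = x₂ ^ n * g` has an entire
solution `A`. -/
theorem exists_differentiable_hasDerivAt_pow_mul {g : ℂ × ℂ → ℂ} (hg : Differentiable ℂ g) (n : ℕ) :
    ∃ A : ℂ × ℂ → ℂ, Differentiable ℂ A ∧ ∀ x : ℂ × ℂ,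
      HasDerivAt (fun s => s ^ (n + 1) * A (x.1, s)) (x.2 ^ n * g x) x.2 := by
  refine ⟨fun x => ∫ t in (0 : ℝ)..1, (t : ℂ) ^ n * g (x.1, t * x.2), ?_, fun x => ?_⟩
  · refine Differentiable.intervalIntegral_of_continuous_uncurry
      (F := fun t (x : ℂ × ℂ) => (t : ℂ) ^ n * g (x.1, t * x.2)) ?_ fun t => ?_
    · have := hg.continuous
      simp only [Function.uncurry_def]
      fun_prop
    · fun_prop
  · exact hasDerivAt_pow_mul_integral_pow_mul (k := fun s => g (x.1, s)) (by fun_prop) n x.2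

/-- Claim 2 in the proof of Theorem 4.5 of the paper: the operator `E` of the local
de Rham complex of the model connection has vanishing cokernel.  For every entire
`η` there are entire `a`, `b` such that, with `ω₁ = x₁^{m₁+1}x₂^{m₂}·a` and
`ω₂ = x₁^{m₁}x₂^{m₂+1}·b`,
`−x₁²∂₁ω₂ + x₂²∂₂ω₁ + m₂x₁^{m₁}x₂^{m₂+1}ω₁ − m₁x₁^{m₁+1}x₂^{m₂}ω₂
  = x₁^{2m₁+1}x₂^{2m₂+1}·η`. -/
theorem cokernel_E_vanishes (m₁ m₂ : ℕ) (hm₁ : 0 < m₁) (hm₂ : 0 < m₂)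
    (η : ℂ × ℂ → ℂ) (hη : Differentiable ℂ η) :
    ∃ a b : ℂ × ℂ → ℂ, Differentiable ℂ a ∧ Differentiable ℂ b ∧
      ∀ x : ℂ × ℂ,
        -x.1 ^ 2 * pd1 (fun y => y.1 ^ m₁ * y.2 ^ (m₂ + 1) * b y) x
          + x.2 ^ 2 * pd2 (fun y => y.1 ^ (m₁ + 1) * y.2 ^ m₂ * a y) x
          + (m₂ : ℂ) * x.1 ^ m₁ * x.2 ^ (m₂ + 1) * (x.1 ^ (m₁ + 1) * x.2 ^ m₂ * a x)
          - (m₁ : ℂ) * x.1 ^ (m₁ + 1) * x.2 ^ m₂ * (x.1 ^ m₁ * x.2 ^ (m₂ + 1) * b x)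
        = x.1 ^ (2 * m₁ + 1) * x.2 ^ (2 * m₂ + 1) * η x := by
  obtain ⟨n, rfl⟩ := Nat.exists_eq_add_one.mpr hm₂
  obtain ⟨A, hA, hA'⟩ := exists_differentiable_hasDerivAt_pow_mul
    (g := fun y => y.1 ^ m₁ * y.2 ^ (n + 1) * Complex.exp (y.1 ^ m₁ * y.2 ^ (n + 1)) * η y)
    (by fun_prop) n
  refine ⟨fun y => Complex.exp (-(y.1 ^ m₁ * y.2 ^ (n + 1))) * A y, fun _ => 0, by fun_prop,
    by fun_prop, fun x => ?_⟩
  have hexp : HasDerivAt (fun s : ℂ => Complex.exp (-(x.1 ^ m₁ * s ^ (n + 1))))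
      (Complex.exp (-(x.1 ^ m₁ * x.2 ^ (n + 1))) * -(x.1 ^ m₁ * ((n + 1 : ℕ) * x.2 ^ n))) x.2 :=
    (((hasDerivAt_pow (n + 1) x.2).const_mul (x.1 ^ m₁)).neg).cexp
  have hω : pd2 (fun y => y.1 ^ (m₁ + 1) * y.2 ^ (n + 1) *
      (Complex.exp (-(y.1 ^ m₁ * y.2 ^ (n + 1))) * A y)) x = _ :=
    (((hexp.mul (hA' x)).const_mul (x.1 ^ (m₁ + 1))).congr_of_eventuallyEq
      (.of_forall fun s => by simp only [Pi.mul_apply]; ring)).deriv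
  have hcancel : Complex.exp (-(x.1 ^ m₁ * x.2 ^ (n + 1))) *
      Complex.exp (x.1 ^ m₁ * x.2 ^ (n + 1)) = 1 := by
    rw [← Complex.exp_add, neg_add_cancel, Complex.exp_zero]
  have hpd1 : pd1 (fun y => y.1 ^ m₁ * y.2 ^ (n + 1 + 1) * (0 : ℂ)) x = 0 := by simp [pd1]
  beta_reduce
  rw [hω, hpd1]
  linear_combination (x.1 ^ (2 * m₁ + 1) * x.2 ^ (2 * (n + 1) + 1) * η x) * hcancel
end

section
/- Let m₁, m₂ be positive integers and set d := gcd(m₁, m₂). The ℂ-linear map E defined by E(g,h) := −x₁²·∂₁h + x₂²·∂₂g + m₂·x₁^{m₁}x₂^{m₂+1}·g − m₁·x₁^{m₁+1}x₂^{m₂}·h maps the subspace P_{m₁, m₂−1} ⊕ P_{m₁−1, m₂} of 𝒪(ℂ²) ⊕ 𝒪(ℂ²) into P_{2m₁, 2m₂}; the kernel of the restricted map E : P_{m₁,m₂−1} ⊕ P_{m₁−1,m₂} → P_{2m₁,2m₂} has dimension d + 2, and its cokernel P_{2m₁,2m₂} / E(P_{m₁,m₂−1} ⊕ P_{m₁−1,m₂})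 has dimension d + 3. In particular this map is Fredholm of index −1. -/
/-- The Taylor coefficient `c_{k,l}(f)` of `f : ℂ × ℂ → ℂ` at the origin:
`1/(k!·l!)` times the value at `0` of the `k`-th iterated `∂₁`-derivative of the
`l`-th iterated `∂₂`-derivative of `f`. -/
noncomputable def taylorCoeff (k l : ℕ) (f : ℂ × ℂ → ℂ) : ℂ :=
  iteratedDeriv k (fun w => iteratedDeriv l (fun v => f (w, v)) 0) 0 /
    ((Nat.factorial k : ℂ) * (Nat.factorial l : ℂ))

/-- `P_{M,N}`: the set of entire functions on `ℂ²` whose Taylor coefficients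
`c_{k,l}` vanish for all `k > M`, `l > N`. -/
def Pset (M N : ℕ) : Set (ℂ × ℂ → ℂ) :=
  {f | Differentiable ℂ f ∧ ∀ k l : ℕ, M < k → N < l → taylorCoeff k l f = 0}

/-- The operator `E(g,h) = −x₁²∂₁h + x₂²∂₂g + m₂x₁^{m₁}x₂^{m₂+1}g − m₁x₁^{m₁+1}x₂^{m₂}h`. -/
noncomputable def Eop (m₁ m₂ : ℕ) (g h : ℂ × ℂ → ℂ) : ℂ × ℂ → ℂ :=
  fun x => -x.1 ^ 2 * pd1 h x + x.2 ^ 2 * pd2 g x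
    + (m₂ : ℂ) * x.1 ^ m₁ * x.2 ^ (m₂ + 1) * g x
    - (m₁ : ℂ) * x.1 ^ (m₁ + 1) * x.2 ^ m₂ * h x

open Metric in
/-- The Taylor coefficients in the second variable of an entire function on `ℂ²` are entire in the
first variable. -/
lemma differentiable_iteratedDeriv_snd {f : ℂ × ℂ → ℂ} (hf : Differentiable ℂ f) (l : ℕ) :
    Differentiable ℂ fun w => iteratedDeriv l (fun v => f (w, v)) 0 := by
  have cauchy (w : ℂ) : iteratedDeriv l (fun v => f (w, v)) 0 =
      (2 * Real.pi * Complex.I / l.factorial)⁻¹ *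
        ∮ z in C(0, 1), (1 / (z - 0) ^ (l + 1)) • f (w, z) := by
    have hw : Differentiable ℂ fun v => f (w, v) := by fun_prop
    have hne : (2 * Real.pi * Complex.I / l.factorial : ℂ) ≠ 0 := by
      simp [Nat.factorial_ne_zero]
    rw [DiffContOnCl.circleIntegral_one_div_sub_center_pow_smul one_pos l hw.diffContOnCl,
      smul_eq_mul, inv_mul_cancel_left₀ hne]
  simp_rw [cauchy]
  refine Differentiable.const_mul (fun w₀ => ?_) _
  have hcont : Continuous f := hf.continuous
  obtain ⟨C, hC⟩ := ((isCompact_closedBall w₀ 2).prod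
    (isCompact_closedBall (0 : ℂ) 1)).exists_bound_of_continuousOn hcont.continuousOn
  have hpow (t : ℝ) : circleMap 0 1 t ≠ 0 := circleMap_ne_center one_ne_zero
  have hmap : Continuous fun t => deriv (circleMap 0 1) t * (1 / circleMap 0 1 t ^ (l + 1)) := by
    simp only [deriv_circleMap]
    fun_prop (disch := simp [hpow])
  simp only [circleIntegral, smul_eq_mul, sub_zero]
  have key := intervalIntegral.hasDerivAt_integral_of_dominated_loc_of_deriv_le
    (μ := MeasureTheory.volume) (a := 0) (b := 2 * Real.pi) (x₀ := w₀) (s := ball w₀ 1)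
    (F := fun w t => deriv (circleMap 0 1) t * (1 / circleMap 0 1 t ^ (l + 1) *
      f (w, circleMap 0 1 t)))
    (F' := fun w t => deriv (circleMap 0 1) t * (1 / circleMap 0 1 t ^ (l + 1) *
      fderiv ℂ f (w, circleMap 0 1 t) (1, 0)))
    (bound := fun _ => C) (ball_mem_nhds w₀ one_pos) ?_ ?_ ?_ ?_ ?_ ?_
  · exact key.2.differentiableAt
  · refine .of_forall fun w => Continuous.aestronglyMeasurable ?_
    simp only [← mul_assoc]
    exact hmap.mul (hcont.comp (by fun_prop))
  · refine Continuous.intervalIntegrable ?_ _ _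
    simp only [← mul_assoc]
    exact hmap.mul (hcont.comp (by fun_prop))
  · simp only [← mul_assoc]
    refine hmap.aestronglyMeasurable.mul (Measurable.aestronglyMeasurable ?_)
    have hpair : Continuous fun t : ℝ => (w₀, circleMap 0 1 t) := by fun_prop
    exact (measurable_fderiv_apply_const ℂ f (1, 0)).comp hpair.measurable
  · refine .of_forall fun t _ w hw => ?_
    have hslice : HasDerivAt (fun w => f (w, circleMap 0 1 t))
        (fderiv ℂ f (w, circleMap 0 1 t) (1, 0)) w :=
      (hf _).hasFDerivAt.comp_hasDerivAt w ((hasDerivAt_id w).prodMk (hasDerivAt_const w _))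
    have hslice' : Differentiable ℂ fun w => f (w, circleMap 0 1 t) := by fun_prop
    have := Complex.norm_deriv_le_of_forall_mem_sphere_norm_le (c := w) (C := C) one_pos
      hslice'.diffContOnCl fun z hz => hC (z, circleMap 0 1 t) ⟨by
        have : dist z w₀ ≤ dist z w + dist w w₀ := dist_triangle _ _ _
        simp only [mem_sphere, mem_ball, mem_closedBall] at *
        linarith, by simp⟩
    rw [hslice.deriv] at this
    simpa using this
  · simp
  · refine .of_forall fun t _ w _ => ?_
    exact (((hf _).hasFDerivAt.comp_hasDerivAt w
      ((hasDerivAt_id w).prodMk (hasDerivAt_const w _))).const_mul _).const_mul _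

/-- Double sequences with the growth of the Taylor coefficients of an entire function on `ℂ²`. -/
def RapidDecay (c : ℕ → ℕ → ℂ) : Prop :=
  ∀ R : ℝ, 1 ≤ R → ∃ C : ℝ, ∀ k l, ‖c k l‖ * R ^ (k + l) ≤ C

namespace RapidDecay

variable {c c' : ℕ → ℕ → ℂ}

lemma summable (hc : RapidDecay c) {R : ℝ} (hR : 1 ≤ R) :
    Summable fun n : ℕ × ℕ => ‖c n.1 n.2‖ * R ^ (n.1 + n.2) := by
  obtain ⟨C, hC⟩ := hc (2 * R) (by linarith)
  have hgeom : Summable fun n : ℕ × ℕ => (1 / 2 : ℝ) ^ n.1 * (1 / 2 : ℝ) ^ n.2 :=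
    summable_geometric_two.mul_of_nonneg summable_geometric_two
      (fun _ => by positivity) (fun _ => by positivity)
  refine .of_nonneg_of_le (fun _ => by positivity) (fun n => ?_) (hgeom.mul_left C)
  calc ‖c n.1 n.2‖ * R ^ (n.1 + n.2)
      = ‖c n.1 n.2‖ * (2 * R) ^ (n.1 + n.2) * ((1 / 2) ^ n.1 * (1 / 2) ^ n.2) := by
        rw [← pow_add, mul_assoc, ← mul_pow]; congr 2; ring
    _ ≤ _ := by gcongr; exact hC _ _

lemma mono (hc : RapidDecay c) (h : ∀ k l, ‖c' k l‖ ≤ ‖c k l‖) : RapidDecay c' := fun R hR =>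
  (hc R hR).imp fun _ hC k l => (by gcongr; exact h k l : _ ≤ _).trans (hC k l)

lemma add (hc : RapidDecay c) (hc' : RapidDecay c') :
    RapidDecay fun k l => c k l + c' k l := by
  intro R hR
  obtain ⟨C, hC⟩ := hc R hR
  obtain ⟨C', hC'⟩ := hc' R hR
  refine ⟨C + C', fun k l => ?_⟩
  calc ‖c k l + c' k l‖ * R ^ (k + l) ≤ (‖c k l‖ + ‖c' k l‖) * R ^ (k + l) := by
        gcongr; exact norm_add_le _ _
    _ ≤ C + C' := by rw [add_mul]; exact add_le_add (hC k l) (hC' k l)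

/-- Rapid decay is stable under multiplication by exponentially bounded factors. -/
lemma mul {t : ℕ → ℕ → ℂ} {D : ℝ} (hc : RapidDecay c)
    (ht : ∀ k l, ‖t k l‖ ≤ D * 2 ^ (k + l)) : RapidDecay fun k l => t k l * c k l := by
  intro R hR
  obtain ⟨C, hC⟩ := hc (2 * R) (by linarith)
  have hD : 0 ≤ D := by simpa using (norm_nonneg _).trans (ht 0 0)
  refine ⟨D * C, fun k l => ?_⟩
  calc ‖t k l * c k l‖ * R ^ (k + l) ≤ D * 2 ^ (k + l) * ‖c k l‖ * R ^ (k + l) := by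
        rw [norm_mul]; gcongr; exact ht k l
    _ = D * (‖c k l‖ * (2 * R) ^ (k + l)) := by rw [mul_pow]; ring
    _ ≤ D * C := by gcongr; exact hC k l

lemma const_mul (hc : RapidDecay c) (a : ℂ) : RapidDecay fun k l => a * c k l :=
  hc.mul (D := ‖a‖) fun _ _ => le_mul_of_one_le_right (norm_nonneg a) (one_le_pow₀ one_le_two)

lemma comp_add (hc : RapidDecay c) (i j : ℕ) : RapidDecay fun k l => c (k + i) (l + j) := by
  intro R hR
  obtain ⟨C, hC⟩ := hc R hR
  refine ⟨C, fun k l => le_trans ?_ (hC (k + i) (l + j))⟩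
  gcongr
  all_goals first | exact hR | omega

/-- Multiplication of a double sequence, seen as a power series, by `x₁ ^ i * x₂ ^ j`. -/
def _root_.shiftCoeff (i j : ℕ) (c : ℕ → ℕ → ℂ) (k l : ℕ) : ℂ :=
  if i ≤ k ∧ j ≤ l then c (k - i) (l - j) else 0

lemma shiftCoeff (hc : RapidDecay c) (i j : ℕ) : RapidDecay (shiftCoeff i j c) := by
  intro R hR
  obtain ⟨C, hC⟩ := hc R hR
  refine ⟨C * R ^ (i + j), fun k l => ?_⟩
  have hC0 : 0 ≤ C := le_trans (by positivity) (hC 0 0)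
  unfold _root_.shiftCoeff
  split_ifs with h
  · have : k + l = (k - i + (l - j)) + (i + j) := by omega
    rw [this, pow_add, ← mul_assoc]
    gcongr
    exact hC _ _
  · simp only [norm_zero, zero_mul]
    positivity

lemma of_support_subset (s : Finset (ℕ × ℕ)) (h : ∀ k l, (k, l) ∉ s → c k l = 0) :
    RapidDecay c := by
  intro R hR
  refine ⟨∑ n ∈ s, ‖c n.1 n.2‖ * R ^ (n.1 + n.2), fun k l => ?_⟩
  by_cases hkl : (k, l) ∈ s
  · exact Finset.single_le_sum (f := fun n : ℕ × ℕ => ‖c n.1 n.2‖ * R ^ (n.1 + n.2))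
      (fun _ _ => by positivity) hkl
  · rw [h k l hkl]
    simp only [norm_zero, zero_mul]
    positivity

end RapidDecay

/-- `f` is the sum of the everywhere convergent power series with coefficients `c`. -/
def HasExpansion (f : ℂ × ℂ → ℂ) (c : ℕ → ℕ → ℂ) : Prop :=
  RapidDecay c ∧ ∀ x : ℂ × ℂ, HasSum (fun n : ℕ × ℕ => c n.1 n.2 * (x.1 ^ n.1 * x.2 ^ n.2)) (f x)

lemma RapidDecay.exists_hasExpansion {c : ℕ → ℕ → ℂ} (hc : RapidDecay c) :
    ∃ f, HasExpansion f c := by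
  refine ⟨fun x => ∑' n : ℕ × ℕ, c n.1 n.2 * (x.1 ^ n.1 * x.2 ^ n.2), hc, fun x => ?_⟩
  refine Summable.hasSum (.of_norm_bounded
    (hc.summable (R := max 1 ‖x‖) (le_max_left _ _)) fun n => ?_)
  rw [norm_mul, norm_mul, norm_pow, norm_pow, pow_add]
  gcongr
  · exact (norm_fst_le x).trans (le_max_right _ _)
  · exact (norm_snd_le x).trans (le_max_right _ _)

lemma Differentiable.exists_hasExpansion {f : ℂ × ℂ → ℂ} (hf : Differentiable ℂ f) :
    ∃ c, HasExpansion f c := by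
  set a : ℕ → ℂ → ℂ := fun l w => (l.factorial : ℂ)⁻¹ * iteratedDeriv l (fun v => f (w, v)) 0
    with ha_def
  have ha (l : ℕ) : Differentiable ℂ (a l) := (differentiable_iteratedDeriv_snd hf l).const_mul _
  set c : ℕ → ℕ → ℂ := fun k l => (k.factorial : ℂ)⁻¹ * iteratedDeriv k (a l) 0 with hc_def
  have hdecay : RapidDecay c := by
    intro R hR
    have hR0 : 0 < R := by linarith
    obtain ⟨C, hC⟩ := ((isCompact_closedBall (0 : ℂ) R).prod
      (isCompact_closedBall (0 : ℂ) R)).exists_bound_of_continuousOn hf.continuous.continuousOn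
    have hbound (l : ℕ) (w : ℂ) (hw : w ∈ Metric.sphere 0 R) : ‖a l w‖ ≤ C / R ^ l := by
      have hslice : Differentiable ℂ fun v => f (w, v) := by fun_prop
      have := Complex.norm_iteratedDeriv_le_of_forall_mem_sphere_norm_le l hR0
        hslice.diffContOnCl fun z hz => hC (w, z)
          ⟨Metric.sphere_subset_closedBall hw, Metric.sphere_subset_closedBall hz⟩
      rw [ha_def, norm_mul, norm_inv, Complex.norm_natCast, inv_mul_le_iff₀ (by positivity)]
      exact this.trans_eq (mul_div_assoc _ _ _)
    refine ⟨C, fun k l => ?_⟩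
    have := Complex.norm_iteratedDeriv_le_of_forall_mem_sphere_norm_le k hR0
      (ha l).diffContOnCl (hbound l)
    rw [hc_def, norm_mul, norm_inv, Complex.norm_natCast]
    calc _ ≤ (k.factorial : ℝ)⁻¹ * (k.factorial * (C / R ^ l) / R ^ k) * R ^ (k + l) := by gcongr
      _ = C := by rw [pow_add]; field_simp
  refine ⟨c, hdecay, fun x => ?_⟩
  obtain ⟨F, hF⟩ := hdecay.exists_hasExpansion
  have hswap : HasSum (fun n : ℕ × ℕ => c n.2 n.1 * (x.1 ^ n.2 * x.2 ^ n.1)) (F x) :=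
    (Equiv.prodComm ℕ ℕ).hasSum_iff.2 (hF.2 x)
  have hinner (l : ℕ) : HasSum (fun k => c k l * (x.1 ^ k * x.2 ^ l)) (a l x.1 * x.2 ^ l) := by
    have := (Complex.hasSum_taylorSeries_of_entire (ha l) 0 x.1).mul_right (x.2 ^ l)
    convert! this using 2 with k
    simp only [hc_def, smul_eq_mul, sub_zero]
    ring
  have houter : HasSum (fun l => a l x.1 * x.2 ^ l) (f x) := by
    have hslice : Differentiable ℂ fun v => f (x.1, v) := by fun_prop
    convert! Complex.hasSum_taylorSeries_of_entire hslice 0 x.2 using 2 with l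
    simp only [ha_def, smul_eq_mul, sub_zero]
    ring
  rw [← (hswap.prod_fiberwise hinner).unique houter]
  exact hF.2 x

namespace HasExpansion

variable {f g : ℂ × ℂ → ℂ} {c c' : ℕ → ℕ → ℂ}

lemma hasFDerivAt (hf : HasExpansion f c) (x : ℂ × ℂ) :
    ∃ L : ℂ × ℂ →L[ℂ] ℂ, HasFDerivAt f L x ∧
      HasSum (fun n : ℕ × ℕ => (n.1 * c n.1 n.2) * (x.1 ^ (n.1 - 1) * x.2 ^ n.2)) (L (1, 0)) ∧
      HasSum (fun n : ℕ × ℕ => (n.2 * c n.1 n.2) * (x.1 ^ n.1 * x.2 ^ (n.2 - 1))) (L (0, 1)) := by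
  obtain ⟨R, hR, hx⟩ : ∃ R : ℝ, 1 ≤ R ∧ ‖x‖ < R :=
    ⟨‖x‖ + 1, by linarith [norm_nonneg x], by linarith⟩
  set T : ℕ × ℕ → ℂ × ℂ → (ℂ × ℂ →L[ℂ] ℂ) := fun n y =>
    ((n.1 * c n.1 n.2) * (y.1 ^ (n.1 - 1) * y.2 ^ n.2)) • ContinuousLinearMap.fst ℂ ℂ ℂ +
    ((n.2 * c n.1 n.2) * (y.1 ^ n.1 * y.2 ^ (n.2 - 1))) • ContinuousLinearMap.snd ℂ ℂ ℂ with hT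
  have hsum := hf.1.summable (R := 2 * R) (by linarith)
  have hbound (n : ℕ × ℕ) (y : ℂ × ℂ) (hy : y ∈ Metric.ball (0 : ℂ × ℂ) R) :
      ‖T n y‖ ≤ ‖c n.1 n.2‖ * (2 * R) ^ (n.1 + n.2) := by
    have hy' : ‖y‖ ≤ R := by simpa using (Metric.mem_ball.1 hy).le
    have h1 := (norm_fst_le y).trans hy'
    have h2 := (norm_snd_le y).trans hy'
    have h3 : ((n.1 + n.2 : ℕ) : ℝ) ≤ 2 ^ (n.1 + n.2) := by
      exact_mod_cast Nat.lt_two_pow_self.le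
    calc ‖T n y‖ ≤ ‖(n.1 * c n.1 n.2) * (y.1 ^ (n.1 - 1) * y.2 ^ n.2)‖ * 1 +
          ‖(n.2 * c n.1 n.2) * (y.1 ^ n.1 * y.2 ^ (n.2 - 1))‖ * 1 := by
          refine (norm_add_le _ _).trans ?_
          rw [norm_smul, norm_smul]
          gcongr
          · exact ContinuousLinearMap.norm_fst_le ..
          · exact ContinuousLinearMap.norm_snd_le ..
      _ ≤ n.1 * ‖c n.1 n.2‖ * (R ^ n.1 * R ^ n.2) + n.2 * ‖c n.1 n.2‖ * (R ^ n.1 * R ^ n.2) := by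
          simp only [norm_mul, norm_pow, Complex.norm_natCast, mul_one]
          gcongr
          · exact (pow_le_pow_left₀ (norm_nonneg _) h1 _).trans
              (pow_le_pow_right₀ hR (Nat.sub_le _ _))
          · exact (pow_le_pow_left₀ (norm_nonneg _) h2 _).trans
              (pow_le_pow_right₀ hR (Nat.sub_le _ _))
      _ = ‖c n.1 n.2‖ * (((n.1 + n.2 : ℕ) : ℝ) * R ^ (n.1 + n.2)) := by push_cast; ring
      _ ≤ _ := by rw [mul_pow]; gcongr
  have hderiv (n : ℕ × ℕ) (y : ℂ × ℂ) :
      HasFDerivAt (fun y : ℂ × ℂ => c n.1 n.2 * (y.1 ^ n.1 * y.2 ^ n.2)) (T n y) y := by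
    convert! (((hasFDerivAt_fst (𝕜 := ℂ) (p := y)).pow n.1).mul
      ((hasFDerivAt_snd (𝕜 := ℂ) (p := y)).pow n.2)).const_mul (c n.1 n.2) using 1
    ext <;> simp [hT] <;> ring
  have hx' : x ∈ Metric.ball (0 : ℂ × ℂ) R := by simpa using hx
  have hD := hasFDerivAt_tsum_of_isPreconnected hsum Metric.isOpen_ball
    (convex_ball (0 : ℂ × ℂ) R).isPreconnected (fun n y _ => hderiv n y) hbound hx'
    (hf.2 x).summable hx'
  have hfun : f = fun y => ∑' n : ℕ × ℕ, c n.1 n.2 * (y.1 ^ n.1 * y.2 ^ n.2) :=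
    funext fun y => (hf.2 y).tsum_eq.symm
  have hTsum : HasSum (fun n => T n x) (∑' n, T n x) :=
    (Summable.of_norm_bounded hsum fun n => hbound n x hx').hasSum
  refine ⟨_, hfun ▸ hD, ?_, ?_⟩
  · simpa [hT] using hTsum.mapL (ContinuousLinearMap.apply ℂ ℂ ((1, 0) : ℂ × ℂ))
  · simpa [hT] using hTsum.mapL (ContinuousLinearMap.apply ℂ ℂ ((0, 1) : ℂ × ℂ))

lemma differentiable (hf : HasExpansion f c) : Differentiable ℂ f := fun x =>
  (hf.hasFDerivAt x).choose_spec.1.differentiableAt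

lemma ext (hf : HasExpansion f c) (hg : HasExpansion g c) : f = g :=
  funext fun x => (hf.2 x).unique (hg.2 x)

lemma add (hf : HasExpansion f c) (hg : HasExpansion g c') :
    HasExpansion (f + g) fun k l => c k l + c' k l :=
  ⟨hf.1.add hg.1, fun x => by simpa only [add_mul, Pi.add_apply] using (hf.2 x).add (hg.2 x)⟩

lemma const_mul (hf : HasExpansion f c) (a : ℂ) :
    HasExpansion (fun x => a * f x) fun k l => a * c k l :=
  ⟨hf.1.const_mul a, fun x => by simpa only [mul_assoc] using (hf.2 x).mul_left a⟩

lemma monomial_mul (hf : HasExpansion f c) (i j : ℕ) :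
    HasExpansion (fun x => x.1 ^ i * x.2 ^ j * f x) (shiftCoeff i j c) := by
  refine ⟨hf.1.shiftCoeff i j, fun x => ?_⟩
  have hinj : Function.Injective fun n : ℕ × ℕ => (n.1 + i, n.2 + j) := by
    rintro ⟨a, b⟩ ⟨a', b'⟩ h
    simp only [Prod.mk.injEq] at h ⊢
    omega
  refine (hinj.hasSum_iff ?_).1 ?_
  · rintro ⟨k, l⟩ hkl
    have : ¬ (i ≤ k ∧ j ≤ l) := fun h => hkl ⟨(k - i, l - j), by
      simp only [Prod.mk.injEq]; omega⟩
    simp [shiftCoeff, this]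
  · convert! (hf.2 x).mul_left (x.1 ^ i * x.2 ^ j) using 2 with n
    simp only [Function.comp_apply, shiftCoeff, Nat.le_add_left, and_self, if_true,
      Nat.add_sub_cancel, pow_add]
    ring

lemma pd1 (hf : HasExpansion f c) :
    HasExpansion (pd1 f) fun k l => (k + 1 : ℕ) * c (k + 1) l := by
  refine ⟨(hf.1.comp_add 1 0).mul (D := 1) fun k l => ?_, fun x => ?_⟩
  · rw [Complex.norm_natCast, one_mul]
    exact_mod_cast Nat.succ_le_of_lt (Nat.lt_two_pow_self.trans_le
      (Nat.pow_le_pow_right two_pos (Nat.le_add_right k l)))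
  · obtain ⟨L, hL, h1, -⟩ := hf.hasFDerivAt x
    have hval : _root_.pd1 f x = L (1, 0) :=
      (hL.comp_hasDerivAt x.1 ((hasDerivAt_id x.1).prodMk (hasDerivAt_const x.1 x.2))).deriv
    have hinj : Function.Injective fun n : ℕ × ℕ => (n.1 + 1, n.2) := by
      rintro ⟨a, b⟩ ⟨a', b'⟩ h
      simpa using h
    rw [hval]
    refine (hinj.hasSum_iff ?_).2 h1
    rintro ⟨k, l⟩ hkl
    have : k = 0 := by
      by_contra hk
      exact hkl ⟨(k - 1, l), Prod.ext (Nat.sub_add_cancel (Nat.pos_of_ne_zero hk)) rfl⟩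
    simp [this]

lemma pd2 (hf : HasExpansion f c) :
    HasExpansion (pd2 f) fun k l => (l + 1 : ℕ) * c k (l + 1) := by
  refine ⟨(hf.1.comp_add 0 1).mul (D := 1) fun k l => ?_, fun x => ?_⟩
  · rw [Complex.norm_natCast, one_mul]
    exact_mod_cast Nat.succ_le_of_lt (Nat.lt_two_pow_self.trans_le
      (Nat.pow_le_pow_right two_pos (Nat.le_add_left l k)))
  · obtain ⟨L, hL, -, h1⟩ := hf.hasFDerivAt x
    have hval : _root_.pd2 f x = L (0, 1) :=
      (hL.comp_hasDerivAt x.2 ((hasDerivAt_const x.2 x.1).prodMk (hasDerivAt_id x.2))).deriv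
    have hinj : Function.Injective fun n : ℕ × ℕ => (n.1, n.2 + 1) := by
      rintro ⟨a, b⟩ ⟨a', b'⟩ h
      simpa using h
    rw [hval]
    refine (hinj.hasSum_iff ?_).2 h1
    rintro ⟨k, l⟩ hkl
    have : l = 0 := by
      by_contra hk
      exact hkl ⟨(k, l - 1), Prod.ext rfl (Nat.sub_add_cancel (Nat.pos_of_ne_zero hk))⟩
    simp [this]

lemma iterate_pd1 (hf : HasExpansion f c) (n : ℕ) :
    HasExpansion (_root_.pd1^[n] f) fun k l => (k + 1).ascFactorial n * c (k + n) l := by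
  induction n generalizing f c with
  | zero => simpa using hf
  | succ n ih =>
    rw [Function.iterate_succ_apply]
    convert ih hf.pd1 using 3 with k l
    rw [show k + (n + 1) = k + n + 1 by ring, ← mul_assoc]
    congr 1
    rw [Nat.ascFactorial_succ]
    push_cast
    ring

lemma iterate_pd2 (hf : HasExpansion f c) (n : ℕ) :
    HasExpansion (_root_.pd2^[n] f) fun k l => (l + 1).ascFactorial n * c k (l + n) := by
  induction n generalizing f c with
  | zero => simpa using hf
  | succ n ih =>
    rw [Function.iterate_succ_apply]
    convert ih hf.pd2 using 3 with k l
    rw [show l + (n + 1) = l + n + 1 by ring, ← mul_assoc]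
    congr 1
    rw [Nat.ascFactorial_succ]
    push_cast
    ring

lemma apply_zero (hf : HasExpansion f c) : f (0, 0) = c 0 0 := by
  refine (hf.2 (0, 0)).unique ?_
  convert hasSum_single (f := fun n : ℕ × ℕ => c n.1 n.2 * ((0 : ℂ) ^ n.1 * 0 ^ n.2)) (0, 0) ?_
  · simp
  · rintro ⟨k, l⟩ h
    by_cases hk : k = 0
    · have hl : l ≠ 0 := by rintro rfl; exact h (by rw [hk])
      simp [hl]
    · simp [hk]

end HasExpansion

lemma iteratedDeriv_fst_eq_iterate_pd1 (n : ℕ) (f : ℂ × ℂ → ℂ) (x : ℂ × ℂ) :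
    iteratedDeriv n (fun w => f (w, x.2)) x.1 = pd1^[n] f x := by
  induction n generalizing f with
  | zero => simp
  | succ n ih => rw [iteratedDeriv_succ', Function.iterate_succ_apply, ← ih]; rfl

lemma iteratedDeriv_snd_eq_iterate_pd2 (n : ℕ) (f : ℂ × ℂ → ℂ) (x : ℂ × ℂ) :
    iteratedDeriv n (fun v => f (x.1, v)) x.2 = pd2^[n] f x := by
  induction n generalizing f with
  | zero => simp
  | succ n ih => rw [iteratedDeriv_succ', Function.iterate_succ_apply, ← ih]; rfl

lemma HasExpansion.taylorCoeff_eq {f : ℂ × ℂ → ℂ} {c : ℕ → ℕ → ℂ} (hf : HasExpansion f c)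
    (k l : ℕ) : taylorCoeff k l f = c k l := by
  have h2 (w : ℂ) := iteratedDeriv_snd_eq_iterate_pd2 l f (w, 0)
  have h1 := iteratedDeriv_fst_eq_iterate_pd1 k (_root_.pd2^[l] f) (0, 0)
  simp only at h1 h2
  simp only [taylorCoeff, h2]
  rw [h1, ((hf.iterate_pd2 l).iterate_pd1 k).apply_zero]
  have := Nat.factorial_ne_zero k
  have := Nat.factorial_ne_zero l
  simp only [zero_add, Nat.one_ascFactorial]
  field_simp

lemma Differentiable.hasExpansion_taylorCoeff {f : ℂ × ℂ → ℂ} (hf : Differentiable ℂ f) :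
    HasExpansion f fun k l => taylorCoeff k l f := by
  obtain ⟨c, hc⟩ := hf.exists_hasExpansion
  simpa only [hc.taylorCoeff_eq] using hc

/-- The power series coefficients of `Eop m₁ m₂ g h`, in terms of those of `g` and `h`. -/
def EopCoeff (m₁ m₂ : ℕ) (a b : ℕ → ℕ → ℂ) (p q : ℕ) : ℂ :=
  -1 * shiftCoeff 2 0 (fun k l => (k + 1 : ℕ) * b (k + 1) l) p q
    + shiftCoeff 0 2 (fun k l => (l + 1 : ℕ) * a k (l + 1)) p q
    + m₂ * shiftCoeff m₁ (m₂ + 1) a p q + -m₁ * shiftCoeff (m₁ + 1) m₂ b p q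

lemma HasExpansion.Eop {g h : ℂ × ℂ → ℂ} {a b : ℕ → ℕ → ℂ} (hg : HasExpansion g a)
    (hh : HasExpansion h b) (m₁ m₂ : ℕ) : HasExpansion (Eop m₁ m₂ g h) (EopCoeff m₁ m₂ a b) := by
  convert! ((((hh.pd1.monomial_mul 2 0).const_mul (-1)).add (hg.pd2.monomial_mul 0 2)).add
    ((hg.monomial_mul m₁ (m₂ + 1)).const_mul m₂)).add
    ((hh.monomial_mul (m₁ + 1) m₂).const_mul (-m₁)) using 1
  funext x
  simp only [_root_.Eop, Pi.add_apply]
  ring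

section Coefficients

variable {m₁ m₂ : ℕ} {a b : ℕ → ℕ → ℂ}

lemma EopCoeff_zero_zero (hm₁ : 0 < m₁) : EopCoeff m₁ m₂ a b 0 0 = 0 := by
  simp [EopCoeff, shiftCoeff, hm₁.ne']

lemma EopCoeff_zero_succ (hm₁ : 0 < m₁) (q : ℕ) :
    EopCoeff m₁ m₂ a b 0 (q + 1) = q * a 0 q := by
  rcases q with _ | q <;> simp [EopCoeff, shiftCoeff, hm₁.ne']

lemma EopCoeff_succ_zero (hm₂ : 0 < m₂) (p : ℕ) :
    EopCoeff m₁ m₂ a b (p + 1) 0 = -(p * b p 0) := by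
  rcases p with _ | p <;> simp [EopCoeff, shiftCoeff, hm₂.ne']

lemma EopCoeff_succ_succ (p q : ℕ) :
    EopCoeff m₁ m₂ a b (p + 1) (q + 1) = q * a (p + 1) q - p * b p (q + 1)
      + (m₂ * shiftCoeff m₁ (m₂ + 1) a (p + 1) (q + 1)
        - m₁ * shiftCoeff (m₁ + 1) m₂ b (p + 1) (q + 1)) := by
  have h1 : shiftCoeff 2 0 (fun k l => (k + 1 : ℕ) * b (k + 1) l) (p + 1) (q + 1) =
      p * b p (q + 1) := by
    rcases p with _ | p <;> simp [shiftCoeff]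
  have h2 : shiftCoeff 0 2 (fun k l => (l + 1 : ℕ) * a k (l + 1)) (p + 1) (q + 1) =
      q * a (p + 1) q := by
    rcases q with _ | q <;> simp [shiftCoeff]
  rw [EopCoeff, h1, h2]
  ring

lemma EopCoeff_succ_add (p q : ℕ) :
    EopCoeff m₁ m₂ a b (p + m₁ + 1) (q + m₂ + 1) =
      (q + m₂ : ℕ) * a (p + m₁ + 1) (q + m₂) - (p + m₁ : ℕ) * b (p + m₁) (q + m₂ + 1)
      + (m₂ * a (p + 1) q - m₁ * b p (q + 1)) := by
  have h1 : shiftCoeff m₁ (m₂ + 1) a (p + m₁ + 1) (q + m₂ + 1) = a (p + 1) q := by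
    rw [shiftCoeff, if_pos (by omega)]
    congr 1 <;> omega
  have h2 : shiftCoeff (m₁ + 1) m₂ b (p + m₁ + 1) (q + m₂ + 1) = b p (q + 1) := by
    rw [shiftCoeff, if_pos (by omega)]
    congr 1 <;> omega
  rw [EopCoeff_succ_succ, h1, h2]

lemma EopCoeff_eq_zero (hm₁ : 0 < m₁) (hm₂ : 0 < m₂)
    (ha : ∀ k l, m₁ < k → m₂ - 1 < l → a k l = 0) (hb : ∀ k l, m₁ - 1 < k → m₂ < l → b k l = 0)
    (p q : ℕ) (hp : 2 * m₁ < p) (hq : 2 * m₂ < q) : EopCoeff m₁ m₂ a b p q = 0 := by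
  obtain ⟨p, rfl⟩ : ∃ p', p = p' + m₁ + 1 := ⟨p - m₁ - 1, by omega⟩
  obtain ⟨q, rfl⟩ : ∃ q', q = q' + m₂ + 1 := ⟨q - m₂ - 1, by omega⟩
  rw [EopCoeff_succ_add, ha _ _ (by omega) (by omega), ha _ _ (by omega) (by omega),
    hb _ _ (by omega) (by omega), hb _ _ (by omega) (by omega)]
  simp

/-- On the resonant positions, those with `p * m₂ = q * m₁`, the two coefficients of `Eop` that
involve `a (p + 1) q` and `b p (q + 1)` are proportional. -/
lemma EopCoeff_resonance (hm₁ : 0 < m₁) (hm₂ : 0 < m₂)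
    (ha : ∀ k l, m₁ < k → m₂ - 1 < l → a k l = 0) (hb : ∀ k l, m₁ - 1 < k → m₂ < l → b k l = 0)
    {p q : ℕ} (hp : p < m₁) (hq : q < m₂) (hpq : p * m₂ = q * m₁) :
    m₂ * EopCoeff m₁ m₂ a b (p + 1) (q + 1) =
      q * EopCoeff m₁ m₂ a b (p + m₁ + 1) (q + m₂ + 1) := by
  have hpq' : (p : ℂ) * m₂ = q * m₁ := by exact_mod_cast hpq
  rw [EopCoeff_succ_add, EopCoeff_succ_succ, ha (p + m₁ + 1) _ (by omega) (by omega),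
    hb (p + m₁) _ (by omega) (by omega), shiftCoeff, if_neg (by omega), shiftCoeff,
    if_neg (by omega)]
  linear_combination -b p (q + 1) * hpq'

lemma lt_and_lt_of_mul_eq_mul {m₁ m₂ p q : ℕ} (hm₁ : 0 < m₁) (hm₂ : 0 < m₂)
    (hpq : p * m₂ = q * m₁) (h : p < m₁ ∨ q < m₂) : p < m₁ ∧ q < m₂ := by
  rcases h with h | h
  · refine ⟨h, lt_of_mul_lt_mul_right (a := m₁) ?_ (Nat.zero_le _)⟩
    rw [← hpq, mul_comm m₂]
    exact Nat.mul_lt_mul_of_pos_right h hm₂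
  · refine ⟨lt_of_mul_lt_mul_right (a := m₂) ?_ (Nat.zero_le _), h⟩
    rw [hpq, mul_comm m₁]
    exact Nat.mul_lt_mul_of_pos_right h hm₁

lemma eq_zero_of_EopCoeff_eq_zero (hm₁ : 0 < m₁) (hm₂ : 0 < m₂)
    (ha : ∀ k l, m₁ < k → m₂ - 1 < l → a k l = 0) (hb : ∀ k l, m₁ - 1 < k → m₂ < l → b k l = 0)
    (hE : ∀ p q, EopCoeff m₁ m₂ a b p q = 0) (ha0 : a 0 0 = 0) (hb0 : b 0 0 = 0)
    (hres : ∀ p q, p < m₁ → q < m₂ → p * m₂ = q * m₁ → a (p + 1) q = 0) :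
    (∀ k l, a k l = 0) ∧ ∀ k l, b k l = 0 := by
  have ha_zero (q : ℕ) : a 0 q = 0 := by
    rcases q with _ | q
    · exact ha0
    · have := hE 0 (q + 1 + 1)
      rw [EopCoeff_zero_succ hm₁] at this
      exact (mul_eq_zero.1 this).resolve_left (by exact_mod_cast q.succ_ne_zero)
  have hb_zero (p : ℕ) : b p 0 = 0 := by
    rcases p with _ | p
    · exact hb0
    · have := hE (p + 1 + 1) 0
      rw [EopCoeff_succ_zero hm₂, neg_eq_zero] at this
      exact (mul_eq_zero.1 this).resolve_left (by exact_mod_cast p.succ_ne_zero)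
  have hab (p q : ℕ) : a (p + 1) q = 0 ∧ b p (q + 1) = 0 := by
    by_cases h : p < m₁ ∨ q < m₂
    swap
    · exact ⟨ha _ _ (by omega) (by omega), hb _ _ (by omega) (by omega)⟩
    have h1 := hE (p + 1) (q + 1)
    have h2 := hE (p + m₁ + 1) (q + m₂ + 1)
    have hsa : shiftCoeff m₁ (m₂ + 1) a (p + 1) (q + 1) = 0 := by
      unfold shiftCoeff
      split_ifs
      · rw [show p + 1 - m₁ = 0 by omega, ha_zero]
      · rfl
    have hsb : shiftCoeff (m₁ + 1) m₂ b (p + 1) (q + 1) = 0 := by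
      unfold shiftCoeff
      split_ifs
      · rw [show q + 1 - m₂ = 0 by omega, hb_zero]
      · rfl
    rw [EopCoeff_succ_succ, hsa, hsb] at h1
    rw [EopCoeff_succ_add, ha (p + m₁ + 1) _ (by omega) (by omega),
      hb (p + m₁) _ (by omega) (by omega)] at h2
    have hm₁' : (m₁ : ℂ) ≠ 0 := by exact_mod_cast hm₁.ne'
    by_cases hpq : p * m₂ = q * m₁
    · obtain ⟨hp, hq⟩ := lt_and_lt_of_mul_eq_mul hm₁ hm₂ hpq h
      have hA := hres p q hp hq hpq
      refine ⟨hA, ?_⟩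
      rw [hA] at h2
      simpa [hm₁'] using h2
    · have hΔ : (p * m₂ - q * m₁ : ℂ) ≠ 0 := sub_ne_zero.2 (by exact_mod_cast hpq)
      constructor
      · refine (mul_eq_zero.1 (?_ : (p * m₂ - q * m₁ : ℂ) * _ = 0)).resolve_left hΔ
        linear_combination -(m₁ : ℂ) * h1 + p * h2
      · refine (mul_eq_zero.1 (?_ : (p * m₂ - q * m₁ : ℂ) * _ = 0)).resolve_left hΔ
        linear_combination -(m₂ : ℂ) * h1 + q * h2
  constructor
  · rintro (_ | p) q
    exacts [ha_zero q, (hab p q).1]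
  · rintro p (_ | q)
    exacts [hb_zero p, (hab p q).2]

lemma norm_inv_intCast_le_one (n : ℤ) : ‖(n : ℂ)⁻¹‖ ≤ 1 := by
  rcases eq_or_ne n 0 with rfl | hn
  · simp
  · rw [norm_inv, Complex.norm_intCast]
    exact inv_le_one_of_one_le₀ (by exact_mod_cast Int.one_le_abs hn)

/-- A rapidly decaying double sequence annihilated by the resonance functionals has a rapidly
decaying preimage, with prescribed values in the directions of the kernel. -/
lemma exists_EopCoeff_eq (hm₁ : 0 < m₁) (hm₂ : 0 < m₂) {f : ℕ → ℕ → ℂ} (hf : RapidDecay f)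
    (hsupp : ∀ k l, 2 * m₁ < k → 2 * m₂ < l → f k l = 0)
    (hf00 : f 0 0 = 0) (hf01 : f 0 1 = 0) (hf10 : f 1 0 = 0)
    (hres : ∀ p q, p < m₁ → q < m₂ → p * m₂ = q * m₁ →
      m₂ * f (p + 1) (q + 1) = q * f (p + m₁ + 1) (q + m₂ + 1))
    (α β : ℂ) (γ : ℕ → ℕ → ℂ) :
    ∃ a b, RapidDecay a ∧ RapidDecay b ∧
      (∀ k l, m₁ < k → m₂ - 1 < l → a k l = 0) ∧ (∀ k l, m₁ - 1 < k → m₂ < l → b k l = 0) ∧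
      (∀ p q, EopCoeff m₁ m₂ a b p q = f p q) ∧ a 0 0 = α ∧ b 0 0 = β ∧
      ∀ p q, p < m₁ → q < m₂ → p * m₂ = q * m₁ → a (p + 1) q = γ p q := by
  -- boundary values, on `k = 0` for `a` and on `l = 0` for `b`
  let a₀ : ℕ → ℕ → ℂ := fun k l =>
    (if k = 0 then (l : ℂ)⁻¹ else 0) * f k (l + 1) + if k = 0 ∧ l = 0 then α else 0
  let b₀ : ℕ → ℕ → ℂ := fun k l =>
    (if l = 0 then -(k : ℂ)⁻¹ else 0) * f (k + 1) l + if k = 0 ∧ l = 0 then β else 0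
  have hinv (n : ℕ) : ‖(n : ℂ)⁻¹‖ ≤ 1 := by simpa using norm_inv_intCast_le_one n
  have hpow (k l : ℕ) : (1 : ℝ) ≤ 2 ^ (k + l) := one_le_pow₀ one_le_two
  have hle_pow (k l : ℕ) : (k : ℝ) ≤ 2 ^ (k + l) := by
    exact_mod_cast Nat.lt_two_pow_self.le.trans (Nat.pow_le_pow_right two_pos (by omega))
  have hle_pow' (k l : ℕ) : (l : ℝ) ≤ 2 ^ (k + l) := add_comm k l ▸ hle_pow l k
  have ha₀ : RapidDecay a₀ := by
    refine ((hf.comp_add 0 1).mul (D := 1) fun k l => ?_).add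
      (.of_support_subset {(0, 0)} fun k l h => if_neg (by simpa using h))
    rw [one_mul]
    split_ifs
    · exact (hinv l).trans (hpow k l)
    · simp
  have hb₀ : RapidDecay b₀ := by
    refine ((hf.comp_add 1 0).mul (D := 1) fun k l => ?_).add
      (.of_support_subset {(0, 0)} fun k l h => if_neg (by simpa using h))
    rw [one_mul]
    split_ifs
    · rw [norm_neg]
      exact (hinv k).trans (hpow k l)
    · simp
  -- right-hand sides and solution of the two by two systems in the interior
  let u : ℕ → ℕ → ℂ := fun p q => f (p + 1) (q + 1) +
    (-m₂ * shiftCoeff m₁ (m₂ + 1) a₀ (p + 1) (q + 1) +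
      m₁ * shiftCoeff (m₁ + 1) m₂ b₀ (p + 1) (q + 1))
  let v : ℕ → ℕ → ℂ := fun p q => f (p + 1 + m₁) (q + 1 + m₂)
  have hu : RapidDecay u := (hf.comp_add 1 1).add
    ((((ha₀.shiftCoeff m₁ (m₂ + 1)).comp_add 1 1).const_mul _).add
      (((hb₀.shiftCoeff (m₁ + 1) m₂).comp_add 1 1).const_mul _))
  have hv : RapidDecay v := by
    simpa only [v, add_assoc] using hf.comp_add (1 + m₁) (1 + m₂)
  let Δ : ℕ → ℕ → ℤ := fun p q => p * m₂ - q * m₁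
  have hΔ (p q : ℕ) : Δ p q = 0 ↔ p * m₂ = q * m₁ := by
    simp only [Δ, sub_eq_zero]; norm_cast
  let A : ℕ → ℕ → ℂ := fun p q => if p < m₁ ∨ q < m₂ then
    ((-m₁ * (Δ p q : ℂ)⁻¹) * u p q + (p * (Δ p q : ℂ)⁻¹) * v p q) +
      if Δ p q = 0 then γ p q else 0 else 0
  let B : ℕ → ℕ → ℂ := fun p q => if p < m₁ ∨ q < m₂ then
    ((-m₂ * (Δ p q : ℂ)⁻¹) * u p q + (q * (Δ p q : ℂ)⁻¹) * v p q) +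
      if Δ p q = 0 then (m₂ * γ p q - v p q) / m₁ else 0 else 0
  have hfactor {x : ℂ} {D y : ℝ} (n : ℤ) (h : ‖x‖ ≤ D * y) : ‖x * (n : ℂ)⁻¹‖ ≤ D * y := by
    rw [norm_mul]
    exact (mul_le_of_le_one_right (norm_nonneg _) (norm_inv_intCast_le_one n)).trans h
  have hsolve {s t : ℕ → ℕ → ℂ} {w : ℕ → ℕ → ℂ} {D : ℝ}
      (hs : ∀ k l, ‖s k l‖ ≤ D * 2 ^ (k + l)) (ht : ∀ k l, ‖t k l‖ ≤ 1 * 2 ^ (k + l)) :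
      RapidDecay fun p q => if p < m₁ ∨ q < m₂ then
        ((s p q * (Δ p q : ℂ)⁻¹) * u p q + (t p q * (Δ p q : ℂ)⁻¹) * v p q) +
          if Δ p q = 0 then w p q else 0 else 0 := by
    refine ((((hu.mul fun k l => hfactor (Δ k l) (hs k l)).add
      (hv.mul fun k l => hfactor (Δ k l) (ht k l)))).add
      (.of_support_subset (Finset.range m₁ ×ˢ Finset.range m₂)
        (c := fun p q => if (p < m₁ ∨ q < m₂) ∧ Δ p q = 0 then w p q else 0)
        fun k l h => if_neg fun h' => h ?_)).mono fun k l => ?_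
    · simpa using lt_and_lt_of_mul_eq_mul hm₁ hm₂ ((hΔ k l).1 h'.2) h'.1
    · by_cases h : k < m₁ ∨ l < m₂ <;> simp [h]
  have hA : RapidDecay A := hsolve (D := m₁)
    (fun k l => by simpa using le_mul_of_one_le_right (Nat.cast_nonneg m₁) (hpow k l))
    (fun k l => by simpa using hle_pow k l)
  have hB : RapidDecay B := hsolve (D := m₂)
    (fun k l => by simpa using le_mul_of_one_le_right (Nat.cast_nonneg m₂) (hpow k l))
    (fun k l => by simpa using hle_pow' k l)
  have hm₁' : (m₁ : ℂ) ≠ 0 := by exact_mod_cast hm₁.ne'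
  have hm₂' : (m₂ : ℂ) ≠ 0 := by exact_mod_cast hm₂.ne'
  have hAB_out (p q : ℕ) (h : ¬ (p < m₁ ∨ q < m₂)) : A p q = 0 ∧ B p q = 0 :=
    ⟨if_neg h, if_neg h⟩
  have hAB_v (p q : ℕ) (h : p < m₁ ∨ q < m₂) : m₂ * A p q - m₁ * B p q = v p q := by
    simp only [A, B, if_pos h]
    by_cases h0 : Δ p q = 0
    · simp only [h0, if_true, Int.cast_zero, inv_zero]
      field_simp
      ring
    · have h0' : (Δ p q : ℂ) ≠ 0 := by exact_mod_cast h0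
      simp only [if_neg h0]
      field_simp
      simp only [Δ]
      push_cast
      ring
  have hAB_u (p q : ℕ) (h : p < m₁ ∨ q < m₂) : q * A p q - p * B p q = u p q := by
    simp only [A, B, if_pos h]
    by_cases h0 : Δ p q = 0
    · have hpq := (hΔ p q).1 h0
      obtain ⟨hp, hq⟩ := lt_and_lt_of_mul_eq_mul hm₁ hm₂ hpq h
      have hpq' : (p : ℂ) * m₂ = q * m₁ := by exact_mod_cast hpq
      have huf : u p q = f (p + 1) (q + 1) := by
        simp only [u, shiftCoeff]
        rw [if_neg (by omega), if_neg (by omega)]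
        simp
      have hvf : v p q = f (p + m₁ + 1) (q + m₂ + 1) := by
        simp only [v, add_right_comm]
      have hr := hres p q hp hq hpq
      rw [← huf, ← hvf] at hr
      simp only [h0, if_true, Int.cast_zero, inv_zero]
      have hr' : m₁ * u p q = p * v p q := mul_left_cancel₀ hm₂' (by
        linear_combination m₁ * hr - v p q * hpq')
      field_simp
      linear_combination -γ p q * hpq' - hr'
    · have h0' : (Δ p q : ℂ) ≠ 0 := by exact_mod_cast h0
      simp only [if_neg h0]
      field_simp
      simp only [Δ]
      push_cast
      ring
  let a : ℕ → ℕ → ℂ := fun k l => a₀ k l + shiftCoeff 1 0 A k l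
  let b : ℕ → ℕ → ℂ := fun k l => b₀ k l + shiftCoeff 0 1 B k l
  have ha_succ (p q : ℕ) : a (p + 1) q = A p q := by simp [a, a₀, shiftCoeff]
  have hb_succ (p q : ℕ) : b p (q + 1) = B p q := by simp [b, b₀, shiftCoeff]
  have ha_zero (q : ℕ) : a 0 q = a₀ 0 q := by simp [a, shiftCoeff]
  have hb_zero (p : ℕ) : b p 0 = b₀ p 0 := by simp [b, shiftCoeff]
  refine ⟨a, b, ha₀.add (hA.shiftCoeff 1 0), hb₀.add (hB.shiftCoeff 0 1), ?_, ?_, ?_, ?_, ?_, ?_⟩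
  · rintro (_ | k) l hk hl
    · omega
    · rw [ha_succ]
      exact (hAB_out k l (by omega)).1
  · rintro k (_ | l) hk hl
    · omega
    · rw [hb_succ]
      exact (hAB_out k l (by omega)).2
  · rintro (_ | p) (_ | q)
    · rw [EopCoeff_zero_zero hm₁, hf00]
    · rw [EopCoeff_zero_succ hm₁, ha_zero]
      rcases q with _ | q
      · simp [hf01]
      · have : ((q + 1 : ℕ) : ℂ) ≠ 0 := by exact_mod_cast q.succ_ne_zero
        simp only [a₀, if_true, Nat.succ_ne_zero, and_false, if_false, add_zero]
        rw [mul_inv_cancel_left₀ this]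
    · rw [EopCoeff_succ_zero hm₂, hb_zero]
      rcases p with _ | p
      · simp [hf10]
      · have : ((p + 1 : ℕ) : ℂ) ≠ 0 := by exact_mod_cast p.succ_ne_zero
        simp only [b₀, if_true, Nat.succ_ne_zero, false_and, if_false, add_zero]
        rw [neg_mul, mul_neg, neg_neg, mul_inv_cancel_left₀ this]
    · by_cases h : p < m₁ ∨ q < m₂
      · have hsa : shiftCoeff m₁ (m₂ + 1) a (p + 1) (q + 1) =
            shiftCoeff m₁ (m₂ + 1) a₀ (p + 1) (q + 1) := by
          unfold shiftCoeff
          split_ifs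
          · rw [show p + 1 - m₁ = 0 by omega, ha_zero]
          · rfl
        have hsb : shiftCoeff (m₁ + 1) m₂ b (p + 1) (q + 1) =
            shiftCoeff (m₁ + 1) m₂ b₀ (p + 1) (q + 1) := by
          unfold shiftCoeff
          split_ifs
          · rw [show q + 1 - m₂ = 0 by omega, hb_zero]
          · rfl
        rw [EopCoeff_succ_succ, ha_succ, hb_succ, hAB_u p q h, hsa, hsb]
        simp only [u]
        ring
      · obtain ⟨p, rfl⟩ : ∃ p', p = p' + m₁ := ⟨p - m₁, by omega⟩
        obtain ⟨q, rfl⟩ : ∃ q', q = q' + m₂ := ⟨q - m₂, by omega⟩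
        rw [EopCoeff_succ_add, ha_succ, hb_succ, ha_succ, hb_succ, (hAB_out _ _ h).1,
          (hAB_out _ _ h).2]
        by_cases h' : p < m₁ ∨ q < m₂
        · rw [hAB_v p q h']
          simp [v, add_right_comm]
        · rw [(hAB_out _ _ h').1, (hAB_out _ _ h').2, hsupp _ _ (by omega) (by omega)]
          simp
  · simp [ha_zero, a₀]
  · simp [hb_zero, b₀]
  · intro p q hp hq hpq
    rw [ha_succ]
    simp only [A, (hΔ p q).2 hpq, if_pos (Or.inl hp)]
    simp

end Coefficients

/-- The resonant positions `(p, q)`. -/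
def resonances (m₁ m₂ : ℕ) : Finset (ℕ × ℕ) :=
  (Finset.range m₁ ×ˢ Finset.range m₂).filter fun n => n.1 * m₂ = n.2 * m₁

lemma mem_resonances {m₁ m₂ : ℕ} {n : ℕ × ℕ} :
    n ∈ resonances m₁ m₂ ↔ n.1 < m₁ ∧ n.2 < m₂ ∧ n.1 * m₂ = n.2 * m₁ := by
  simp [resonances, and_assoc]

lemma card_resonances {m₁ m₂ : ℕ} (hm₁ : 0 < m₁) (hm₂ : 0 < m₂) :
    (resonances m₁ m₂).card = Nat.gcd m₁ m₂ := by
  obtain ⟨d, r, s, hd, hcop, rfl, rfl⟩ := Nat.exists_coprime' (Nat.gcd_pos_of_pos_left m₂ hm₁)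
  have hr : 0 < r := Nat.pos_of_mul_pos_right hm₁
  have hs : 0 < s := Nat.pos_of_mul_pos_right hm₂
  rw [Nat.gcd_mul_right, hcop.gcd_eq_one, one_mul]
  conv_rhs => rw [← Finset.card_range d]
  refine (Finset.card_bij (fun t _ => (t * r, t * s)) ?_ ?_ ?_).symm
  · intro t ht
    have ht' := Finset.mem_range.1 ht
    refine mem_resonances.2 ⟨?_, ?_, by ring⟩
    · rw [mul_comm r]; exact Nat.mul_lt_mul_of_pos_right ht' hr
    · rw [mul_comm s]; exact Nat.mul_lt_mul_of_pos_right ht' hs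
  · intro t _ t' _ h
    exact Nat.eq_of_mul_eq_mul_right hr (congrArg Prod.fst h)
  · rintro ⟨p, q⟩ h
    obtain ⟨hp, hq, hpq⟩ := mem_resonances.1 h
    simp only at hp hq hpq
    have hpq' : p * s = q * r := Nat.eq_of_mul_eq_mul_right hd (by linarith)
    obtain ⟨t, rfl⟩ : r ∣ p := hcop.dvd_of_dvd_mul_right ⟨q, by rw [hpq', mul_comm]⟩
    refine ⟨t, Finset.mem_range.2 (lt_of_mul_lt_mul_left hp (Nat.zero_le r)), ?_⟩
    have : t * s = q := Nat.eq_of_mul_eq_mul_right hr (by rw [← hpq']; ring)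
    rw [this, mul_comm]

lemma hasExpansion_zero : HasExpansion 0 fun _ _ => 0 :=
  ⟨fun _ _ => ⟨0, by simp⟩, fun x => by simp⟩

lemma taylorCoeff_add {f g : ℂ × ℂ → ℂ} (hf : Differentiable ℂ f) (hg : Differentiable ℂ g)
    (k l : ℕ) : taylorCoeff k l (f + g) = taylorCoeff k l f + taylorCoeff k l g :=
  (hf.hasExpansion_taylorCoeff.add hg.hasExpansion_taylorCoeff).taylorCoeff_eq k l

lemma taylorCoeff_smul {f : ℂ × ℂ → ℂ} (hf : Differentiable ℂ f) (a : ℂ) (k l : ℕ) :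
    taylorCoeff k l (a • f) = a * taylorCoeff k l f :=
  (hf.hasExpansion_taylorCoeff.const_mul a).taylorCoeff_eq k l

/-- `Pset M N` as a submodule. -/
def psetSubmodule (M N : ℕ) : Submodule ℂ (ℂ × ℂ → ℂ) where
  carrier := Pset M N
  zero_mem' := ⟨differentiable_const 0, fun k l _ _ => hasExpansion_zero.taylorCoeff_eq k l⟩
  add_mem' := fun ⟨hf, hf'⟩ ⟨hg, hg'⟩ => ⟨hf.add hg, fun k l hk hl => by
    rw [taylorCoeff_add hf hg, hf' k l hk hl, hg' k l hk hl, add_zero]⟩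
  smul_mem' := fun a _ ⟨hf, hf'⟩ => ⟨hf.const_smul a, fun k l hk hl => by
    rw [taylorCoeff_smul hf, hf' k l hk hl, mul_zero]⟩

lemma HasExpansion.mem_Pset {f : ℂ × ℂ → ℂ} {c : ℕ → ℕ → ℂ} {M N : ℕ} (hf : HasExpansion f c)
    (hc : ∀ k l, M < k → N < l → c k l = 0) : f ∈ Pset M N :=
  ⟨hf.differentiable, fun k l hk hl => (hf.taylorCoeff_eq k l).trans (hc k l hk hl)⟩

lemma Eop_mem_Pset {m₁ m₂ : ℕ} (hm₁ : 0 < m₁) (hm₂ : 0 < m₂) {g h : ℂ × ℂ → ℂ}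
    (hg : g ∈ Pset m₁ (m₂ - 1)) (hh : h ∈ Pset (m₁ - 1) m₂) :
    Eop m₁ m₂ g h ∈ Pset (2 * m₁) (2 * m₂) :=
  (hg.1.hasExpansion_taylorCoeff.Eop hh.1.hasExpansion_taylorCoeff m₁ m₂).mem_Pset
    (EopCoeff_eq_zero hm₁ hm₂ hg.2 hh.2)

lemma Eop_add (m₁ m₂ : ℕ) {g g' h h' : ℂ × ℂ → ℂ} (hg : Differentiable ℂ g)
    (hg' : Differentiable ℂ g') (hh : Differentiable ℂ h) (hh' : Differentiable ℂ h') :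
    Eop m₁ m₂ (g + g') (h + h') = Eop m₁ m₂ g h + Eop m₁ m₂ g' h' := by
  have hpd1 (x : ℂ × ℂ) : pd1 (h + h') x = pd1 h x + pd1 h' x :=
    deriv_fun_add (f := fun w => h (w, x.2)) (g := fun w => h' (w, x.2)) (by fun_prop) (by fun_prop)
  have hpd2 (x : ℂ × ℂ) : pd2 (g + g') x = pd2 g x + pd2 g' x :=
    deriv_fun_add (f := fun w => g (x.1, w)) (g := fun w => g' (x.1, w)) (by fun_prop) (by fun_prop)
  funext x
  simp only [Eop, hpd1, hpd2, Pi.add_apply]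
  ring

lemma Eop_smul (m₁ m₂ : ℕ) {g h : ℂ × ℂ → ℂ} (hg : Differentiable ℂ g) (hh : Differentiable ℂ h)
    (a : ℂ) : Eop m₁ m₂ (a • g) (a • h) = a • Eop m₁ m₂ g h := by
  have hpd1 (x : ℂ × ℂ) : pd1 (a • h) x = a * pd1 h x :=
    deriv_const_mul (d := fun w => h (w, x.2)) a (by fun_prop)
  have hpd2 (x : ℂ × ℂ) : pd2 (a • g) x = a * pd2 g x :=
    deriv_const_mul (d := fun w => g (x.1, w)) a (by fun_prop)
  funext x
  simp only [Eop, hpd1, hpd2, Pi.smul_apply, smul_eq_mul]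
  ring

/-- `Eop m₁ m₂` as a linear map `P_{m₁,m₂-1} ⊕ P_{m₁-1,m₂} → P_{2m₁,2m₂}`. -/
noncomputable def EopLinear {m₁ m₂ : ℕ} (hm₁ : 0 < m₁) (hm₂ : 0 < m₂) :
    psetSubmodule m₁ (m₂ - 1) × psetSubmodule (m₁ - 1) m₂ →ₗ[ℂ]
      psetSubmodule (2 * m₁) (2 * m₂) where
  toFun p := ⟨Eop m₁ m₂ p.1 p.2, Eop_mem_Pset hm₁ hm₂ p.1.2 p.2.2⟩
  map_add' p p' := Subtype.ext (Eop_add m₁ m₂ p.1.2.1 p'.1.2.1 p.2.2.1 p'.2.2.1)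
  map_smul' a p := Subtype.ext (Eop_smul m₁ m₂ p.1.2.1 p.2.2.1 a)

/-- The coefficients parametrizing the kernel of `EopLinear`. -/
noncomputable def kernelCoordinates (m₁ m₂ : ℕ) :
    psetSubmodule m₁ (m₂ - 1) × psetSubmodule (m₁ - 1) m₂ →ₗ[ℂ]
      ℂ × ℂ × (resonances m₁ m₂ → ℂ) where
  toFun p := (taylorCoeff 0 0 (p.1 : ℂ × ℂ → ℂ), taylorCoeff 0 0 (p.2 : ℂ × ℂ → ℂ),
    fun n => taylorCoeff (n.1.1 + 1) n.1.2 (p.1 : ℂ × ℂ → ℂ))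
  map_add' p p' := Prod.ext (taylorCoeff_add p.1.2.1 p'.1.2.1 0 0)
    (Prod.ext (taylorCoeff_add p.2.2.1 p'.2.2.1 0 0)
      (funext fun _ => taylorCoeff_add p.1.2.1 p'.1.2.1 _ _))
  map_smul' a p := Prod.ext (taylorCoeff_smul p.1.2.1 a 0 0)
    (Prod.ext (taylorCoeff_smul p.2.2.1 a 0 0)
      (funext fun _ => taylorCoeff_smul p.1.2.1 a _ _))

/-- The functionals cutting out the range of `EopLinear`. -/
noncomputable def rangeFunctionals (m₁ m₂ : ℕ) :
    psetSubmodule (2 * m₁) (2 * m₂) →ₗ[ℂ] ℂ × ℂ × ℂ × (resonances m₁ m₂ → ℂ) where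
  toFun f := (taylorCoeff 0 0 (f : ℂ × ℂ → ℂ), taylorCoeff 0 1 (f : ℂ × ℂ → ℂ),
    taylorCoeff 1 0 (f : ℂ × ℂ → ℂ), fun n =>
      m₂ * taylorCoeff (n.1.1 + 1) (n.1.2 + 1) (f : ℂ × ℂ → ℂ) -
        n.1.2 * taylorCoeff (n.1.1 + m₁ + 1) (n.1.2 + m₂ + 1) (f : ℂ × ℂ → ℂ))
  map_add' f g := by
    simp only [Submodule.coe_add, taylorCoeff_add f.2.1 g.2.1, Prod.mk_add_mk]
    congr 3
    funext n
    simp only [Pi.add_apply]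
    ring
  map_smul' a f := by
    simp only [Submodule.coe_smul, taylorCoeff_smul f.2.1, RingHom.id_apply, Prod.smul_mk,
      smul_eq_mul]
    congr 3
    funext n
    simp only [Pi.smul_apply, smul_eq_mul]
    ring

section Fredholm

variable {m₁ m₂ : ℕ} (hm₁ : 0 < m₁) (hm₂ : 0 < m₂)

lemma kernelCoordinates_ker_injective : Function.Injective
    ((kernelCoordinates m₁ m₂).domRestrict (LinearMap.ker (EopLinear hm₁ hm₂))) := by
  refine (injective_iff_map_eq_zero _).2 ?_
  rintro ⟨⟨g, h⟩, hp⟩ h0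
  have hE : Eop m₁ m₂ g h = 0 := congrArg Subtype.val (LinearMap.mem_ker.1 hp)
  have hexp := g.2.1.hasExpansion_taylorCoeff.Eop h.2.1.hasExpansion_taylorCoeff m₁ m₂
  rw [hE] at hexp
  simp only [LinearMap.domRestrict_apply, kernelCoordinates, LinearMap.coe_mk, AddHom.coe_mk,
    Prod.mk_eq_zero] at h0
  obtain ⟨hg0, hh0, hres⟩ := h0
  obtain ⟨hg, hh⟩ := eq_zero_of_EopCoeff_eq_zero hm₁ hm₂ g.2.2 h.2.2
    (fun p q => by rw [← hexp.taylorCoeff_eq, hasExpansion_zero.taylorCoeff_eq])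
    hg0 hh0 fun p q hp hq hpq => congrFun hres ⟨(p, q), mem_resonances.2 ⟨hp, hq, hpq⟩⟩
  have hg' := g.2.1.hasExpansion_taylorCoeff
  have hh' := h.2.1.hasExpansion_taylorCoeff
  simp only [hg] at hg'
  simp only [hh] at hh'
  exact Subtype.ext (Prod.ext (Subtype.ext (hg'.ext hasExpansion_zero))
    (Subtype.ext (hh'.ext hasExpansion_zero)))

lemma kernelCoordinates_ker_surjective : Function.Surjective
    ((kernelCoordinates m₁ m₂).domRestrict (LinearMap.ker (EopLinear hm₁ hm₂))) := by
  rintro ⟨α, β, γ⟩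
  obtain ⟨a, b, ha, hb, ha', hb', hE, ha0, hb0, hres⟩ := exists_EopCoeff_eq hm₁ hm₂
    hasExpansion_zero.1 (fun _ _ _ _ => rfl) rfl rfl rfl (by simp) α β
    (fun p q => if h : (p, q) ∈ resonances m₁ m₂ then γ ⟨(p, q), h⟩ else 0)
  obtain ⟨g, hg⟩ := ha.exists_hasExpansion
  obtain ⟨h, hh⟩ := hb.exists_hasExpansion
  have hzero : Eop m₁ m₂ g h = 0 := by
    have hexp := hg.Eop hh m₁ m₂
    rw [show EopCoeff m₁ m₂ a b = fun _ _ => 0 from funext₂ hE] at hexp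
    exact hexp.ext hasExpansion_zero
  refine ⟨⟨(⟨g, hg.mem_Pset ha'⟩, ⟨h, hh.mem_Pset hb'⟩),
    LinearMap.mem_ker.2 (Subtype.ext hzero)⟩, ?_⟩
  simp only [LinearMap.domRestrict_apply, kernelCoordinates, LinearMap.coe_mk, AddHom.coe_mk,
    hg.taylorCoeff_eq, hh.taylorCoeff_eq, ha0, hb0]
  congr 2
  funext ⟨n, hn⟩
  obtain ⟨h1, h2, h3⟩ := mem_resonances.1 hn
  simp [hres _ _ h1 h2 h3, hn]

lemma ker_rangeFunctionals :
    LinearMap.ker (rangeFunctionals m₁ m₂) = LinearMap.range (EopLinear hm₁ hm₂) := by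
  ext f
  simp only [LinearMap.mem_ker, LinearMap.mem_range, rangeFunctionals, LinearMap.coe_mk,
    AddHom.coe_mk, Prod.mk_eq_zero]
  constructor
  · rintro ⟨h00, h01, h10, hres⟩
    obtain ⟨a, b, ha, hb, ha', hb', hE, -⟩ := exists_EopCoeff_eq hm₁ hm₂
      f.2.1.hasExpansion_taylorCoeff.1 f.2.2 h00 h01 h10 (fun p q hp hq hpq =>
        sub_eq_zero.1 (congrFun hres ⟨(p, q), mem_resonances.2 ⟨hp, hq, hpq⟩⟩)) 0 0 0
    obtain ⟨g, hg⟩ := ha.exists_hasExpansion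
    obtain ⟨h, hh⟩ := hb.exists_hasExpansion
    refine ⟨(⟨g, hg.mem_Pset ha'⟩, ⟨h, hh.mem_Pset hb'⟩), Subtype.ext ?_⟩
    have hexp := hg.Eop hh m₁ m₂
    rw [show EopCoeff m₁ m₂ a b = _ from funext₂ hE] at hexp
    exact hexp.ext f.2.1.hasExpansion_taylorCoeff
  · rintro ⟨⟨g, h⟩, rfl⟩
    have hexp := g.2.1.hasExpansion_taylorCoeff.Eop h.2.1.hasExpansion_taylorCoeff m₁ m₂
    simp only [EopLinear, LinearMap.coe_mk, AddHom.coe_mk, hexp.taylorCoeff_eq]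
    refine ⟨EopCoeff_zero_zero hm₁, ?_, ?_, ?_⟩
    · simpa using EopCoeff_zero_succ hm₁ 0
    · simpa using EopCoeff_succ_zero hm₂ 0
    · funext ⟨n, hn⟩
      obtain ⟨h1, h2, h3⟩ := mem_resonances.1 hn
      exact sub_eq_zero.2 (EopCoeff_resonance hm₁ hm₂ g.2.2 h.2.2 h1 h2 h3)

end Fredholm

lemma rangeFunctionals_surjective {m₁ m₂ : ℕ} (hm₂ : 0 < m₂) :
    Function.Surjective (rangeFunctionals m₁ m₂) := by
  rintro ⟨α, β, δ, γ⟩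
  have hm₂' : (m₂ : ℂ) ≠ 0 := by exact_mod_cast hm₂.ne'
  let c : ℕ → ℕ → ℂ
    | 0, 0 => α
    | 0, 1 => β
    | 0, _ + 2 => 0
    | p + 1, 0 => if p = 0 then δ else 0
    | p + 1, q + 1 => if h : (p, q) ∈ resonances m₁ m₂ then γ ⟨(p, q), h⟩ / m₂ else 0
  have hsupp (k l : ℕ) (h : m₁ + 1 < k ∨ m₂ + 1 < l) : c k l = 0 := by
    match k, l with
    | 0, 0 => omega
    | 0, 1 => omega
    | 0, _ + 2 => rfl
    | p + 1, 0 => exact if_neg (by omega)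
    | p + 1, q + 1 =>
      refine dif_neg fun hn => ?_
      obtain ⟨h1, h2, -⟩ := mem_resonances.1 hn
      simp only at h1 h2
      omega
  have hdecay : RapidDecay c := by
    refine .of_support_subset (Finset.range (m₁ + 2) ×ˢ Finset.range (m₂ + 2)) fun k l h => ?_
    simp only [Finset.mem_product, Finset.mem_range] at h
    exact hsupp k l (by omega)
  obtain ⟨f, hf⟩ := hdecay.exists_hasExpansion
  refine ⟨⟨f, hf.mem_Pset fun k l hk hl => hsupp k l (by omega)⟩, ?_⟩
  simp only [rangeFunctionals, LinearMap.coe_mk, AddHom.coe_mk, hf.taylorCoeff_eq]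
  congr 3
  funext ⟨n, hn⟩
  have h1 : c (n.1 + 1) (n.2 + 1) = γ ⟨n, hn⟩ / m₂ := dif_pos hn
  have h2 : c (n.1 + m₁ + 1) (n.2 + m₂ + 1) = 0 := by
    refine dif_neg fun hn' : (n.1 + m₁, n.2 + m₂) ∈ resonances m₁ m₂ => ?_
    have := (mem_resonances.1 hn').1
    simp only at this
    omega
  simp only [h1, h2]
  field_simp
  ring

/-- Lemma 4.7 (lem:PFred) of the paper: the operator
`E : P_{m₁,m₂−1} ⊕ P_{m₁−1,m₂} → P_{2m₁,2m₂}` is well defined and Fredholm with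
kernel of dimension `gcd(m₁,m₂) + 2`, cokernel of dimension `gcd(m₁,m₂) + 3`,
hence index `−1`. -/
theorem Eop_fredholm_index_neg_one (m₁ m₂ : ℕ) (hm₁ : 0 < m₁) (hm₂ : 0 < m₂) :
    (∀ g h : ℂ × ℂ → ℂ, g ∈ Pset m₁ (m₂ - 1) → h ∈ Pset (m₁ - 1) m₂ →
      Eop m₁ m₂ g h ∈ Pset (2 * m₁) (2 * m₂)) ∧
    ∃ (K : Submodule ℂ ((ℂ × ℂ → ℂ) × (ℂ × ℂ → ℂ)))
      (P2 Im : Submodule ℂ (ℂ × ℂ → ℂ)),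
      (∀ p : (ℂ × ℂ → ℂ) × (ℂ × ℂ → ℂ), p ∈ K ↔
        p.1 ∈ Pset m₁ (m₂ - 1) ∧ p.2 ∈ Pset (m₁ - 1) m₂ ∧ Eop m₁ m₂ p.1 p.2 = 0) ∧
      (∀ f : ℂ × ℂ → ℂ, f ∈ P2 ↔ f ∈ Pset (2 * m₁) (2 * m₂)) ∧
      (∀ f : ℂ × ℂ → ℂ, f ∈ Im ↔
        ∃ g h : ℂ × ℂ → ℂ, g ∈ Pset m₁ (m₂ - 1) ∧ h ∈ Pset (m₁ - 1) m₂ ∧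
          Eop m₁ m₂ g h = f) ∧
      Im ≤ P2 ∧
      Module.finrank ℂ K = Nat.gcd m₁ m₂ + 2 ∧
      Module.finrank ℂ (P2 ⧸ Im.comap P2.subtype) = Nat.gcd m₁ m₂ + 3 ∧
      (Module.finrank ℂ K : ℤ) -
        (Module.finrank ℂ (P2 ⧸ Im.comap P2.subtype) : ℤ) = -1 := by
  let K := LinearMap.ker (EopLinear hm₁ hm₂)
  let ι := (psetSubmodule m₁ (m₂ - 1)).subtype.prodMap (psetSubmodule (m₁ - 1) m₂).subtype
  have hι : Function.Injective ι := Subtype.val_injective.prodMap Subtype.val_injective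
  let P2 := psetSubmodule (2 * m₁) (2 * m₂)
  have hcomap : ((LinearMap.range (EopLinear hm₁ hm₂)).map P2.subtype).comap P2.subtype =
      LinearMap.ker (rangeFunctionals m₁ m₂) := by
    rw [Submodule.comap_map_eq_of_injective Subtype.val_injective, ker_rangeFunctionals hm₁ hm₂]
  have hK : Module.finrank ℂ (K.map ι) = Nat.gcd m₁ m₂ + 2 := by
    rw [← (K.equivMapOfInjective ι hι).finrank_eq, (LinearEquiv.ofBijective _
      ⟨kernelCoordinates_ker_injective hm₁ hm₂, kernelCoordinates_ker_surjective hm₁ hm₂⟩).finrank_eq]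
    simp only [Module.finrank_prod, Module.finrank_self, Module.finrank_fintype_fun_eq_card,
      Fintype.card_coe, card_resonances hm₁ hm₂]
    ring
  have hQ : Module.finrank ℂ (P2 ⧸ ((LinearMap.range (EopLinear hm₁ hm₂)).map
      P2.subtype).comap P2.subtype) = Nat.gcd m₁ m₂ + 3 := by
    rw [hcomap, ((rangeFunctionals m₁ m₂).quotKerEquivOfSurjective
      (rangeFunctionals_surjective hm₂)).finrank_eq]
    simp only [Module.finrank_prod, Module.finrank_self, Module.finrank_fintype_fun_eq_card,
      Fintype.card_coe, card_resonances hm₁ hm₂]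
    ring
  refine ⟨fun g h hg hh => Eop_mem_Pset hm₁ hm₂ hg hh, K.map ι, P2,
    (LinearMap.range (EopLinear hm₁ hm₂)).map P2.subtype, fun p => ?_, fun f => Iff.rfl,
    fun f => ?_, Submodule.map_subtype_le _ _, hK, hQ, by rw [hK, hQ]; push_cast; ring⟩
  · constructor
    · rintro ⟨q, hq, rfl⟩
      exact ⟨q.1.2, q.2.2, congrArg Subtype.val (LinearMap.mem_ker.1 hq)⟩
    · rintro ⟨hg, hh, hE⟩
      exact ⟨(⟨p.1, hg⟩, ⟨p.2, hh⟩), LinearMap.mem_ker.2 (Subtype.ext hE), rfl⟩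
  · constructor
    · rintro ⟨_, ⟨q, rfl⟩, rfl⟩
      exact ⟨q.1, q.2, q.1.2, q.2.2, rfl⟩
    · rintro ⟨g, h, hg, hh, rfl⟩
      exact ⟨_, ⟨(⟨g, hg⟩, ⟨h, hh⟩), rfl⟩, rfl⟩
end

section
/- Let m₁, m₂ be positive integers. Define D′ : 𝒪(ℂ²) → 𝒪(ℂ²) ⊕ 𝒪(ℂ²) by D′u := (∂₁u + m₁·x₁^{m₁−1}x₂^{m₂}·u, ∂₂u + m₂·x₁^{m₁}x₂^{m₂−1}·u) and E′ : 𝒪(ℂ²) ⊕ 𝒪(ℂ²) → 𝒪(ℂ²) by E′(ω₁,ω₂) := ∂₁ω₂ − ∂₂ω₁ + m₁·x₁^{m₁−1}x₂^{m₂}·ω₂ − m₂·x₁^{m₁}x₂^{m₂−1}·ω₁. Then E′ ∘ D′ = 0, the three ℂ-vector spaces ker D′, (ker E′)/(im D′) and 𝒪(ℂ²)/(im E′) are finite-dimensional, and dim ker D′ − dim((ker E′)/(im D′)) + dim(𝒪(ℂ²)/(im E′)) = 1. -/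
/-- `𝒪(ℂ²)`: the ℂ-subspace of entire functions inside all functions `ℂ × ℂ → ℂ`. -/
noncomputable def entireSubmodule : Submodule ℂ (ℂ × ℂ → ℂ) where
  carrier := {f | Differentiable ℂ f}
  add_mem' := fun hf hg => hf.add hg
  zero_mem' := differentiable_const (𝕜 := ℂ) (E := ℂ × ℂ) (0 : ℂ)
  smul_mem' := fun c f hf => hf.const_smul c

/-- First component of `D′u = (∂₁u + m₁x₁^{m₁−1}x₂^{m₂}u, ∂₂u + m₂x₁^{m₁}x₂^{m₂−1}u)`. -/
noncomputable def D'1 (m₁ m₂ : ℕ) (u : ℂ × ℂ → ℂ) : ℂ × ℂ → ℂ :=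
  fun x => pd1 u x + (m₁ : ℂ) * x.1 ^ (m₁ - 1) * x.2 ^ m₂ * u x

/-- Second component of `D′`. -/
noncomputable def D'2 (m₁ m₂ : ℕ) (u : ℂ × ℂ → ℂ) : ℂ × ℂ → ℂ :=
  fun x => pd2 u x + (m₂ : ℂ) * x.1 ^ m₁ * x.2 ^ (m₂ - 1) * u x

/-- `E′(ω₁,ω₂) = ∂₁ω₂ − ∂₂ω₁ + m₁x₁^{m₁−1}x₂^{m₂}ω₂ − m₂x₁^{m₁}x₂^{m₂−1}ω₁`. -/
noncomputable def E' (m₁ m₂ : ℕ) (ω₁ ω₂ : ℂ × ℂ → ℂ) : ℂ × ℂ → ℂ :=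
  fun x => pd1 ω₂ x - pd2 ω₁ x + (m₁ : ℂ) * x.1 ^ (m₁ - 1) * x.2 ^ m₂ * ω₂ x
    - (m₂ : ℂ) * x.1 ^ m₁ * x.2 ^ (m₂ - 1) * ω₁ x

open Complex MeasureTheory Metric Set

/-- An interval integral of a jointly continuous family of entire functions is entire. -/
theorem differentiable_intervalIntegral_of_entire {K : ℂ × ℂ → ℝ → ℂ} (a b : ℝ)
    (hK : Continuous fun p : (ℂ × ℂ) × ℝ => K p.1 p.2)
    (hd : ∀ t, Differentiable ℂ fun x => K x t) :
    Differentiable ℂ fun x => ∫ t in a..b, K x t := by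
  intro x₀
  obtain ⟨M, hM⟩ := ((isCompact_closedBall x₀ 2).prod
    (isCompact_uIcc (a := a) (b := b))).exists_bound_of_continuousOn hK.continuousOn
  have hcont : ∀ x, Continuous (K x) := fun x => hK.comp (by fun_prop : Continuous fun t => (x, t))
  have hmeas : Measurable fun t => fderiv ℂ (fun x => K x t) x₀ :=
    (measurable_fderiv_with_param ℂ (f := fun t x => K x t) (hK.comp continuous_swap)).comp
      (measurable_id.prodMk measurable_const)
  refine (intervalIntegral.hasFDerivAt_integral_of_dominated_of_fderiv_le (𝕜 := ℂ)
    (s := ball x₀ 1) (F' := fun x t => fderiv ℂ (fun y => K y t) x) (bound := fun _ => (M + M) / 1)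
    (ball_mem_nhds x₀ one_pos)
    (.of_forall fun x => (hcont x).aestronglyMeasurable)
    ((hcont x₀).intervalIntegrable _ _) hmeas.aestronglyMeasurable ?_ (by simp)
    (.of_forall fun t _ x _ => (hd t x).hasFDerivAt)).differentiableAt
  refine .of_forall fun t ht x hx => ?_
  have hbound : ∀ y ∈ ball x 1, ‖K y t‖ ≤ M := fun y hy => by
    refine hM (y, t) ⟨?_, uIoc_subset_uIcc ht⟩
    have := dist_triangle y x x₀
    simp only [mem_ball] at hx hy
    simp only [mem_closedBall]
    linarith
  refine norm_fderiv_le_div_of_mapsTo_ball (hd t).differentiableOn (fun y hy => ?_) one_pos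
  rw [mem_closedBall, dist_eq_norm]
  exact (norm_sub_le _ _).trans (add_le_add (hbound y hy) (hbound x (mem_ball_self one_pos)))

theorem hasDerivAt_pd1 {f : ℂ × ℂ → ℂ} (hf : Differentiable ℂ f) (x : ℂ × ℂ) :
    HasDerivAt (fun w => f (w, x.2)) (pd1 f x) x.1 :=
  DifferentiableAt.hasDerivAt
    ((hf.comp (by fun_prop : Differentiable ℂ fun w : ℂ => (w, x.2))) x.1)

theorem hasDerivAt_pd2 {f : ℂ × ℂ → ℂ} (hf : Differentiable ℂ f) (x : ℂ × ℂ) :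
    HasDerivAt (fun w => f (x.1, w)) (pd2 f x) x.2 :=
  DifferentiableAt.hasDerivAt
    ((hf.comp (by fun_prop : Differentiable ℂ fun w : ℂ => (x.1, w))) x.2)

theorem HasFDerivAt.pd1_eq {f : ℂ × ℂ → ℂ} {f' : ℂ × ℂ →L[ℂ] ℂ} {x : ℂ × ℂ}
    (hf : HasFDerivAt f f' x) : pd1 f x = f' (1, 0) :=
  (hf.comp_hasDerivAt x.1 ((hasDerivAt_id x.1).prodMk (hasDerivAt_const x.1 x.2))).deriv

theorem HasFDerivAt.pd2_eq {f : ℂ × ℂ → ℂ} {f' : ℂ × ℂ →L[ℂ] ℂ} {x : ℂ × ℂ}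
    (hf : HasFDerivAt f f' x) : pd2 f x = f' (0, 1) :=
  (hf.comp_hasDerivAt x.2 ((hasDerivAt_const x.2 x.1).prodMk (hasDerivAt_id x.2))).deriv

/-- The differential form `a dx₁ + b dx₂`. -/
noncomputable def oneForm (a b : ℂ × ℂ → ℂ) (x : ℂ × ℂ) : ℂ × ℂ →L[ℂ] ℂ :=
  a x • ContinuousLinearMap.fst ℂ ℂ ℂ + b x • ContinuousLinearMap.snd ℂ ℂ ℂ

theorem hasFDerivAt_oneForm_pd {f : ℂ × ℂ → ℂ} (hf : Differentiable ℂ f) (x : ℂ × ℂ) :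
    HasFDerivAt f (oneForm (pd1 f) (pd2 f) x) x := by
  convert (hf x).hasFDerivAt using 1
  ext <;> simp [oneForm, (hf x).hasFDerivAt.pd1_eq, (hf x).hasFDerivAt.pd2_eq]

theorem hasFDerivAt_oneForm {a b : ℂ × ℂ → ℂ} (ha : Differentiable ℂ a)
    (hb : Differentiable ℂ b) (x : ℂ × ℂ) :
    HasFDerivAt (oneForm a b)
      ((oneForm (pd1 a) (pd2 a) x).smulRight (ContinuousLinearMap.fst ℂ ℂ ℂ) +
        (oneForm (pd1 b) (pd2 b) x).smulRight (ContinuousLinearMap.snd ℂ ℂ ℂ)) x :=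
  ((hasFDerivAt_oneForm_pd ha x).smul_const (ContinuousLinearMap.fst ℂ ℂ ℂ)).add
    ((hasFDerivAt_oneForm_pd hb x).smul_const (ContinuousLinearMap.snd ℂ ℂ ℂ))

theorem differentiable_pd1 {f : ℂ × ℂ → ℂ} (hf : Differentiable ℂ f) :
    Differentiable ℂ (pd1 f) := by
  have key : pd1 f = fun x => (2 * Real.pi * I : ℂ)⁻¹ * ∫ θ in (0 : ℝ)..2 * Real.pi,
      circleMap 0 1 θ * I * ((circleMap 0 1 θ ^ 2)⁻¹ * f (circleMap 0 1 θ + x.1, x.2)) := by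
    funext x
    have h := two_pi_I_inv_smul_circleIntegral_sub_sq_inv_smul_of_differentiable isOpen_univ
      (subset_univ (closedBall x.1 1))
      (hf.comp (by fun_prop : Differentiable ℂ fun w : ℂ => (w, x.2))).differentiableOn
      (mem_ball_self one_pos)
    simp only [circleIntegral, deriv_circleMap, circleMap_sub_center, smul_eq_mul] at h
    rw [pd1]
    refine h.symm.trans ?_
    simp [circleMap, add_comm]
  rw [key]
  refine (differentiable_intervalIntegral_of_entire _ _ ?_ fun t => ?_).const_mul _
  · have hne : ∀ θ : ℝ, circleMap 0 1 θ ^ 2 ≠ 0 := fun θ => by simp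
    have hfc := hf.continuous
    have hc : Continuous fun p : (ℂ × ℂ) × ℝ => circleMap 0 1 p.2 :=
      (continuous_circleMap 0 1).comp continuous_snd
    exact (hc.mul continuous_const).mul (((hc.pow 2).inv₀ fun p => hne p.2).mul (by fun_prop))
  · fun_prop

theorem differentiable_pd2 {f : ℂ × ℂ → ℂ} (hf : Differentiable ℂ f) :
    Differentiable ℂ (pd2 f) := by
  have hs : Differentiable ℂ (Prod.swap : ℂ × ℂ → ℂ × ℂ) :=
    differentiable_snd.prodMk differentiable_fst
  exact (differentiable_pd1 (hf.comp hs)).comp hs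

theorem pd1_pd2_comm {f : ℂ × ℂ → ℂ} (hf : Differentiable ℂ f) :
    pd1 (pd2 f) = pd2 (pd1 f) := by
  funext x
  have h := second_derivative_symmetric (hasFDerivAt_oneForm_pd hf)
    (hasFDerivAt_oneForm (differentiable_pd1 hf) (differentiable_pd2 hf) x) (1, 0) (0, 1)
  simpa [oneForm] using h

/-- A closed holomorphic `1`-form on `ℂ²` is exact. -/
theorem exists_primitive_of_closed {a b : ℂ × ℂ → ℂ} (ha : Differentiable ℂ a)
    (hb : Differentiable ℂ b) (hab : pd1 b = pd2 a) :
    ∃ u : ℂ × ℂ → ℂ, Differentiable ℂ u ∧ pd1 u = a ∧ pd2 u = b := by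
  obtain ⟨u, hu⟩ :=
    Convex.exists_forall_hasFDerivWithinAt_of_hasFDerivWithinAt_symmetric (convex_univ (𝕜 := ℝ))
      (fun x _ => ((hasFDerivAt_oneForm ha hb x).restrictScalars ℝ).hasFDerivWithinAt)
      (fun x _ v _ w _ => by
        simp only [oneForm, hab, ContinuousLinearMap.coe_restrictScalars', add_apply,
          ContinuousLinearMap.smulRight_apply, smul_apply,
          ContinuousLinearMap.coe_fst', ContinuousLinearMap.coe_snd', smul_eq_mul]
        ring)
  have hu' : ∀ x, HasFDerivAt u (oneForm a b x) x := fun x => (hu x trivial).hasFDerivAt (by simp)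
  refine ⟨u, fun x => (hu' x).differentiableAt, ?_, ?_⟩
  · funext x; simp [(hu' x).pd1_eq, oneForm]
  · funext x; simp [(hu' x).pd2_eq, oneForm]

/-- Every entire function on `ℂ²` has an entire primitive in the first variable. -/
theorem exists_pd1_eq {f : ℂ × ℂ → ℂ} (hf : Differentiable ℂ f) :
    ∃ u : ℂ × ℂ → ℂ, Differentiable ℂ u ∧ pd1 u = f := by
  refine ⟨fun x => ∫ t in (0 : ℝ)..1, x.1 * f (t * x.1, x.2),
    differentiable_intervalIntegral_of_entire _ _ ?_ fun t => by fun_prop, ?_⟩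
  · have hfc := hf.continuous
    fun_prop
  · funext x
    have hs : Differentiable ℂ fun w : ℂ => f (w, x.2) := by fun_prop
    obtain ⟨G, hG⟩ := hs.isExactOn_univ
    have hint : ∀ w : ℂ, ∫ t in (0 : ℝ)..1, w * f (t * w, x.2) = G w - G 0 := fun w => by
      have hderiv : ∀ t : ℝ, HasDerivAt (fun t : ℝ => G (t * w)) (w * f (t * w, x.2)) t :=
        fun t => by
          have h := (hG (t * w) trivial).comp_of_eq (t : ℂ)
            ((hasDerivAt_id (t : ℂ)).mul_const w) rfl
          simpa [mul_comm] using h.comp_ofReal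
      have hfc := hf.continuous
      have := intervalIntegral.integral_eq_sub_of_hasDerivAt (a := 0) (b := 1)
        (fun t _ => hderiv t) (Continuous.intervalIntegrable (by fun_prop) _ _)
      simpa using this
    simp only [pd1, hint]
    exact ((hG x.1 trivial).sub_const _).deriv

/-- The weight `exp (x₁^m₁ x₂^m₂)`, which conjugates the twisted complex to the de Rham complex. -/
noncomputable def weight (m₁ m₂ : ℕ) (x : ℂ × ℂ) : ℂ := exp (x.1 ^ m₁ * x.2 ^ m₂)

theorem weight_ne_zero (m₁ m₂ : ℕ) (x : ℂ × ℂ) : weight m₁ m₂ x ≠ 0 := exp_ne_zero _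

theorem differentiable_weight (m₁ m₂ : ℕ) : Differentiable ℂ (weight m₁ m₂) := by
  unfold weight; fun_prop

theorem pd1_weight_mul (m₁ m₂ : ℕ) {u : ℂ × ℂ → ℂ} (hu : Differentiable ℂ u) :
    pd1 (weight m₁ m₂ * u) = weight m₁ m₂ * D'1 m₁ m₂ u := by
  funext x
  refine ((((hasDerivAt_pow m₁ x.1).mul_const (x.2 ^ m₂)).cexp).mul
    (hasDerivAt_pd1 hu x)).deriv.trans ?_
  simp only [weight, D'1, Pi.mul_apply]
  ring

theorem pd2_weight_mul (m₁ m₂ : ℕ) {u : ℂ × ℂ → ℂ} (hu : Differentiable ℂ u) :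
    pd2 (weight m₁ m₂ * u) = weight m₁ m₂ * D'2 m₁ m₂ u := by
  funext x
  refine ((((hasDerivAt_pow m₂ x.2).const_mul (x.1 ^ m₁)).cexp).mul
    (hasDerivAt_pd2 hu x)).deriv.trans ?_
  simp only [weight, D'2, Pi.mul_apply]
  ring

theorem weight_mul_E' (m₁ m₂ : ℕ) {a b : ℂ × ℂ → ℂ} (ha : Differentiable ℂ a)
    (hb : Differentiable ℂ b) :
    weight m₁ m₂ * E' m₁ m₂ a b = pd1 (weight m₁ m₂ * b) - pd2 (weight m₁ m₂ * a) := by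
  rw [pd1_weight_mul m₁ m₂ hb, pd2_weight_mul m₁ m₂ ha]
  funext x
  simp only [E', D'1, D'2, Pi.mul_apply, Pi.sub_apply]
  ring

theorem weight_mul_cancel {m₁ m₂ : ℕ} {f g : ℂ × ℂ → ℂ}
    (h : weight m₁ m₂ * f = weight m₁ m₂ * g) : f = g :=
  funext fun x => mul_left_cancel₀ (weight_ne_zero m₁ m₂ x) (congrFun h x)

theorem exists_eq_weight_mul (m₁ m₂ : ℕ) {v : ℂ × ℂ → ℂ} (hv : Differentiable ℂ v) :
    ∃ u : ℂ × ℂ → ℂ, Differentiable ℂ u ∧ weight m₁ m₂ * u = v :=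
  ⟨fun x => (weight m₁ m₂ x)⁻¹ * v x,
    ((differentiable_weight m₁ m₂).inv (weight_ne_zero m₁ m₂)).mul hv,
    funext fun x => mul_inv_cancel_left₀ (weight_ne_zero m₁ m₂ x) _⟩

theorem differentiable_D'1 (m₁ m₂ : ℕ) {u : ℂ × ℂ → ℂ} (hu : Differentiable ℂ u) :
    Differentiable ℂ (D'1 m₁ m₂ u) := by
  have := differentiable_pd1 hu
  unfold D'1; fun_prop

theorem differentiable_D'2 (m₁ m₂ : ℕ) {u : ℂ × ℂ → ℂ} (hu : Differentiable ℂ u) :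
    Differentiable ℂ (D'2 m₁ m₂ u) := by
  have := differentiable_pd2 hu
  unfold D'2; fun_prop

theorem differentiable_E' (m₁ m₂ : ℕ) {a b : ℂ × ℂ → ℂ} (ha : Differentiable ℂ a)
    (hb : Differentiable ℂ b) : Differentiable ℂ (E' m₁ m₂ a b) := by
  have := differentiable_pd2 ha
  have := differentiable_pd1 hb
  unfold E'; fun_prop

theorem E'_D' (m₁ m₂ : ℕ) {u : ℂ × ℂ → ℂ} (hu : Differentiable ℂ u) :
    E' m₁ m₂ (D'1 m₁ m₂ u) (D'2 m₁ m₂ u) = 0 := by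
  apply weight_mul_cancel (m₁ := m₁) (m₂ := m₂)
  rw [weight_mul_E' m₁ m₂ (differentiable_D'1 m₁ m₂ hu) (differentiable_D'2 m₁ m₂ hu),
    ← pd1_weight_mul m₁ m₂ hu, ← pd2_weight_mul m₁ m₂ hu,
    pd1_pd2_comm ((differentiable_weight m₁ m₂).mul hu), sub_self, mul_zero]

theorem exists_D'_eq (m₁ m₂ : ℕ) {a b : ℂ × ℂ → ℂ} (ha : Differentiable ℂ a)
    (hb : Differentiable ℂ b) (hab : E' m₁ m₂ a b = 0) :
    ∃ u : ℂ × ℂ → ℂ, Differentiable ℂ u ∧ (a, b) = (D'1 m₁ m₂ u, D'2 m₁ m₂ u) := by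
  have hw := differentiable_weight m₁ m₂
  have hclosed : pd1 (weight m₁ m₂ * b) = pd2 (weight m₁ m₂ * a) := by
    rw [← sub_eq_zero, ← weight_mul_E' m₁ m₂ ha hb, hab, mul_zero]
  obtain ⟨v, hv, hv₁, hv₂⟩ := exists_primitive_of_closed (hw.mul ha) (hw.mul hb) hclosed
  obtain ⟨u, hu, rfl⟩ := exists_eq_weight_mul m₁ m₂ hv
  rw [pd1_weight_mul m₁ m₂ hu] at hv₁
  rw [pd2_weight_mul m₁ m₂ hu] at hv₂
  exact ⟨u, hu, Prod.ext (weight_mul_cancel hv₁.symm) (weight_mul_cancel hv₂.symm)⟩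

theorem exists_E'_eq (m₁ m₂ : ℕ) {f : ℂ × ℂ → ℂ} (hf : Differentiable ℂ f) :
    ∃ a b : ℂ × ℂ → ℂ, Differentiable ℂ a ∧ Differentiable ℂ b ∧ E' m₁ m₂ a b = f := by
  obtain ⟨v, hv, hvf⟩ := exists_pd1_eq ((differentiable_weight m₁ m₂).mul hf)
  obtain ⟨b, hb, rfl⟩ := exists_eq_weight_mul m₁ m₂ hv
  have h0 : Differentiable ℂ (0 : ℂ × ℂ → ℂ) := differentiable_const 0
  refine ⟨0, b, h0, hb, weight_mul_cancel (m₁ := m₁) (m₂ := m₂) ?_⟩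
  rw [weight_mul_E' m₁ m₂ h0 hb, hvf, mul_zero]
  funext x
  simp [pd2]

theorem D'_eq_zero_iff (m₁ m₂ : ℕ) {u : ℂ × ℂ → ℂ} (hu : Differentiable ℂ u) :
    D'1 m₁ m₂ u = 0 ∧ D'2 m₁ m₂ u = 0 ↔ ∃ c : ℂ, c • (weight m₁ m₂)⁻¹ = u := by
  have hwu := (differentiable_weight m₁ m₂).mul hu
  constructor
  · rintro ⟨h₁, h₂⟩
    have hconst := is_const_of_fderiv_eq_zero hwu fun x => by
      rw [(hasFDerivAt_oneForm_pd hwu x).fderiv, oneForm, pd1_weight_mul m₁ m₂ hu,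
        pd2_weight_mul m₁ m₂ hu, h₁, h₂]
      ext <;> simp
    refine ⟨weight m₁ m₂ 0 * u 0, funext fun x => ?_⟩
    have hx : weight m₁ m₂ 0 * u 0 = weight m₁ m₂ x * u x := hconst 0 x
    rw [Pi.smul_apply, Pi.inv_apply, smul_eq_mul, hx, mul_comm (weight m₁ m₂ x),
      mul_inv_cancel_right₀ (weight_ne_zero m₁ m₂ x)]
  · rintro ⟨c, rfl⟩
    have hc : weight m₁ m₂ * (c • (weight m₁ m₂)⁻¹) = fun _ => c := funext fun x => by
      simp only [Pi.mul_apply, Pi.smul_apply, Pi.inv_apply, smul_eq_mul]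
      field_simp [weight_ne_zero m₁ m₂ x]
    constructor <;> apply weight_mul_cancel (m₁ := m₁) (m₂ := m₂)
    · rw [← pd1_weight_mul m₁ m₂ hu, hc]
      funext x
      simp [pd1]
    · rw [← pd2_weight_mul m₁ m₂ hu, hc]
      funext x
      simp [pd2]

theorem D'1_add (m₁ m₂ : ℕ) {u v : ℂ × ℂ → ℂ} (hu : Differentiable ℂ u)
    (hv : Differentiable ℂ v) : D'1 m₁ m₂ (u + v) = D'1 m₁ m₂ u + D'1 m₁ m₂ v := by
  funext x
  have h : pd1 (u + v) x = pd1 u x + pd1 v x :=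
    ((hasDerivAt_pd1 hu x).add (hasDerivAt_pd1 hv x)).deriv
  simp only [D'1, h, Pi.add_apply]
  ring

theorem D'2_add (m₁ m₂ : ℕ) {u v : ℂ × ℂ → ℂ} (hu : Differentiable ℂ u)
    (hv : Differentiable ℂ v) : D'2 m₁ m₂ (u + v) = D'2 m₁ m₂ u + D'2 m₁ m₂ v := by
  funext x
  have h : pd2 (u + v) x = pd2 u x + pd2 v x :=
    ((hasDerivAt_pd2 hu x).add (hasDerivAt_pd2 hv x)).deriv
  simp only [D'2, h, Pi.add_apply]
  ring

theorem D'1_smul (m₁ m₂ : ℕ) (c : ℂ) {u : ℂ × ℂ → ℂ} (hu : Differentiable ℂ u) :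
    D'1 m₁ m₂ (c • u) = c • D'1 m₁ m₂ u := by
  funext x
  have h : pd1 (c • u) x = c * pd1 u x := ((hasDerivAt_pd1 hu x).const_mul c).deriv
  simp only [D'1, h, Pi.smul_apply, smul_eq_mul]
  ring

theorem D'2_smul (m₁ m₂ : ℕ) (c : ℂ) {u : ℂ × ℂ → ℂ} (hu : Differentiable ℂ u) :
    D'2 m₁ m₂ (c • u) = c • D'2 m₁ m₂ u := by
  funext x
  have h : pd2 (c • u) x = c * pd2 u x := ((hasDerivAt_pd2 hu x).const_mul c).deriv
  simp only [D'2, h, Pi.smul_apply, smul_eq_mul]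
  ring

/-- The operator `D′` as a linear map on entire functions. -/
noncomputable def linearD' (m₁ m₂ : ℕ) :
    entireSubmodule →ₗ[ℂ] (ℂ × ℂ → ℂ) × (ℂ × ℂ → ℂ) where
  toFun u := (D'1 m₁ m₂ u, D'2 m₁ m₂ u)
  map_add' u v := Prod.ext (D'1_add m₁ m₂ u.2 v.2) (D'2_add m₁ m₂ u.2 v.2)
  map_smul' c u := Prod.ext (D'1_smul m₁ m₂ c u.2) (D'2_smul m₁ m₂ c u.2)

theorem mem_range_linearD' (m₁ m₂ : ℕ) (ω : (ℂ × ℂ → ℂ) × (ℂ × ℂ → ℂ)) :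
    ω ∈ (linearD' m₁ m₂).range ↔
      ∃ u : ℂ × ℂ → ℂ, Differentiable ℂ u ∧ ω = (D'1 m₁ m₂ u, D'2 m₁ m₂ u) :=
  ⟨fun ⟨u, hu⟩ => ⟨u, u.2, hu.symm⟩, fun ⟨u, hu, h⟩ => ⟨⟨u, hu⟩, h.symm⟩⟩

/-- The final lemma in the proof of Theorem 4.5 of the paper: the complex
`0 → 𝒪(ℂ²) →^{D′} 𝒪(ℂ²)⊕𝒪(ℂ²) →^{E′} 𝒪(ℂ²) → 0` has finite-dimensional
cohomology and Euler characteristic `1`. -/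
theorem euler_characteristic_unperturbed_complex
    (m₁ m₂ : ℕ) (hm₁ : 0 < m₁) (hm₂ : 0 < m₂) :
    (∀ u : ℂ × ℂ → ℂ, Differentiable ℂ u →
      E' m₁ m₂ (D'1 m₁ m₂ u) (D'2 m₁ m₂ u) = 0) ∧
    ∃ (KD : Submodule ℂ (ℂ × ℂ → ℂ))
      (KE ID : Submodule ℂ ((ℂ × ℂ → ℂ) × (ℂ × ℂ → ℂ)))
      (IE : Submodule ℂ (ℂ × ℂ → ℂ)),
      (∀ u : ℂ × ℂ → ℂ, u ∈ KD ↔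
        Differentiable ℂ u ∧ D'1 m₁ m₂ u = 0 ∧ D'2 m₁ m₂ u = 0) ∧
      (∀ ω : (ℂ × ℂ → ℂ) × (ℂ × ℂ → ℂ), ω ∈ KE ↔
        Differentiable ℂ ω.1 ∧ Differentiable ℂ ω.2 ∧ E' m₁ m₂ ω.1 ω.2 = 0) ∧
      (∀ ω : (ℂ × ℂ → ℂ) × (ℂ × ℂ → ℂ), ω ∈ ID ↔
        ∃ u : ℂ × ℂ → ℂ, Differentiable ℂ u ∧ ω = (D'1 m₁ m₂ u, D'2 m₁ m₂ u)) ∧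
      (∀ f : ℂ × ℂ → ℂ, f ∈ IE ↔
        ∃ ω₁ ω₂ : ℂ × ℂ → ℂ, Differentiable ℂ ω₁ ∧ Differentiable ℂ ω₂ ∧
          E' m₁ m₂ ω₁ ω₂ = f) ∧
      ID ≤ KE ∧ IE ≤ entireSubmodule ∧
      Module.Finite ℂ KD ∧
      Module.Finite ℂ (KE ⧸ ID.comap KE.subtype) ∧
      Module.Finite ℂ (entireSubmodule ⧸ IE.comap entireSubmodule.subtype) ∧
      (Module.finrank ℂ KD : ℤ)
        - (Module.finrank ℂ (KE ⧸ ID.comap KE.subtype) : ℤ)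
        + (Module.finrank ℂ (entireSubmodule ⧸ IE.comap entireSubmodule.subtype) : ℤ)
        = 1 := by
  have hquot : ∀ {V : Type} [AddCommGroup V] [Module ℂ V] (S : Submodule ℂ V),
      Subsingleton (S ⧸ S.comap S.subtype) := fun S => by
    rw [Submodule.comap_subtype_self]; infer_instance
  have hKE := hquot (linearD' m₁ m₂).range
  have hIE := hquot entireSubmodule
  have hinv : Differentiable ℂ (weight m₁ m₂)⁻¹ :=
    (differentiable_weight m₁ m₂).inv (weight_ne_zero m₁ m₂)
  refine ⟨fun u hu => E'_D' m₁ m₂ hu, Submodule.span ℂ {(weight m₁ m₂)⁻¹},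
    (linearD' m₁ m₂).range, (linearD' m₁ m₂).range, entireSubmodule, fun u => ?_, fun ω => ?_,
    mem_range_linearD' m₁ m₂, fun f => ⟨exists_E'_eq m₁ m₂, ?_⟩, le_rfl, le_rfl,
    inferInstance, inferInstance, inferInstance, ?_⟩
  · rw [Submodule.mem_span_singleton]
    constructor
    · rintro ⟨c, rfl⟩
      have hd : Differentiable ℂ (c • (weight m₁ m₂)⁻¹) := hinv.const_smul c
      exact ⟨hd, (D'_eq_zero_iff m₁ m₂ hd).2 ⟨c, rfl⟩⟩
    · rintro ⟨hu, h⟩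
      exact (D'_eq_zero_iff m₁ m₂ hu).1 h
  · rw [mem_range_linearD']
    constructor
    · rintro ⟨u, hu, rfl⟩
      exact ⟨differentiable_D'1 m₁ m₂ hu, differentiable_D'2 m₁ m₂ hu, E'_D' m₁ m₂ hu⟩
    · rintro ⟨h₁, h₂, h⟩
      exact exists_D'_eq m₁ m₂ h₁ h₂ h
  · rintro ⟨a, b, ha, hb, rfl⟩
    exact differentiable_E' m₁ m₂ ha hb
  · have hne : (weight m₁ m₂)⁻¹ ≠ 0 := fun h =>
      inv_ne_zero (weight_ne_zero m₁ m₂ 0) (congrFun h 0)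
    rw [finrank_span_singleton hne, Module.finrank_zero_of_subsingleton,
      Module.finrank_zero_of_subsingleton]
    norm_num
end
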